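/- arXiv:1905.03566 — 2 statements merged into one kernel-verified Lean document; each statement's English description precedes it below -/
import Mathlib

section
/- Let (μ_t) be a compactly supported measure-valued probability solution of the kinetic herding equation on [0,T) with 0 ≤ φ ≤ φ_M and uniformly bounded second velocity moment ∫ |v|² dμ_t ≤ m_2. Then the supports are uniformly bounded on compact time intervals: for each t < T there is a constant C(t) such that R_x(s) < C(t) and R_v(s) < C(t) for all 0 ≤ s ≤ t, where R_x(s) = sup{|x| : ∃ v with (x,v) ∈ supp(μ_s)} and R_v(s) = sup{|v| : ∃ x with (x,v) ∈ supp(μ_s)}. Equivalently, along any bi-characteristic starting in supp(μ_0), sup_{0≤t≤T}(|X_μ(t;0,x,v)| + |V_μ(t;0,x,v)|) ≤ C_T. -/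
open MeasureTheory Filter Set RealInnerProductSpace

noncomputable section

abbrev Euc (d : ℕ) := EuclideanSpace ℝ (Fin d)
abbrev Phase (d : ℕ) := Euc d × Euc d

/-- The nonlocal herding force `Q(x,v,μ)`. -/
noncomputable def herdQ {d : ℕ} (lw lx lv : ℝ) (φ : ℝ → ℝ) (μ : Measure (Phase d))
    (x v : Euc d) : Euc d :=
  ∫ z, (lw • (z.1 - x) + (lx * φ ‖x - z.1‖) • (z.1 - x)
      + (lv * φ ‖x - z.1‖) • (z.2 - v)) ∂μ

/-- Measure-valued solution of the kinetic herding equation on the time set `S`: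
(i) finiteness, (ii) weak continuity in time against functions vanishing at infinity,
(iii) the weak formulation against compactly supported `C¹` test functions. -/
def IsMVSol {d : ℕ} (lw lx lv : ℝ) (φ : ℝ → ℝ) (S : Set ℝ)
    (μ : ℝ → Measure (Phase d)) : Prop :=
  (∀ t ∈ S, IsFiniteMeasure (μ t)) ∧
  (∀ g : ZeroAtInftyContinuousMap (Phase d) ℝ,
      ContinuousOn (fun t => ∫ z, g z ∂(μ t)) S) ∧
  (∀ g : Phase d × ℝ → ℝ, ContDiff ℝ 1 g → HasCompactSupport g →
    ∀ t ∈ S,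
      (∫ z, g (z, t) ∂(μ t)) - (∫ z, g (z, 0) ∂(μ 0)) =
      ∫ s in (0:ℝ)..t, (∫ z,
        (deriv (fun u => g (z, u)) s
          + (fderiv ℝ (fun y => g ((y, z.2), s)) z.1) z.2
          + (fderiv ℝ (fun w => g ((z.1, w), s)) z.2)
              (herdQ lw lx lv φ (μ s) z.1 z.2)) ∂(μ s)))

/-- Topological support of a measure. -/
def msupport {d : ℕ} (μ : Measure (Phase d)) : Set (Phase d) :=
  {z | ∀ U : Set (Phase d), IsOpen U → z ∈ U → 0 < μ U}

/-- A measure has compact support. -/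
def MeasureCompactSupport {d : ℕ} (μ : Measure (Phase d)) : Prop :=
  ∃ K : Set (Phase d), IsCompact K ∧ μ Kᶜ = 0

/-- Wasserstein-1 distance in duality formulation: supremum of `|∫ g dμ - ∫ g dν|` over
functions `g` with `sup |g| ≤ 1` and Lipschitz constant `≤ 1`. -/
noncomputable def W1 {d : ℕ} (μ ν : Measure (Phase d)) : ℝ :=
  sSup {r : ℝ | ∃ g : Phase d → ℝ, (∀ z, |g z| ≤ 1) ∧ LipschitzWith 1 g ∧
    r = |(∫ z, g z ∂μ) - ∫ z, g z ∂ν|}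

section Herd

def en {d : ℕ} (z : Phase d) : ℝ := ‖z.1‖ ^ 2 + ‖z.2‖ ^ 2

def PB {d : ℕ} (μ : Measure (Phase d)) (N : ℝ) : Prop := ∀ᵐ z ∂μ, en z ≤ N

lemma PB.mono {d : ℕ} {μ : Measure (Phase d)} {N N' : ℝ} (h : PB μ N) (hN : N ≤ N') : PB μ N' := by
  filter_upwards [h] with z hz using hz.trans hN

lemma en_cont {d : ℕ} : Continuous (en (d := d)) := by unfold en; fun_prop

lemma en_nonneg {d : ℕ} (z : Phase d) : 0 ≤ en z := by unfold en; positivity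

lemma PB.nonneg {d : ℕ} {μ : Measure (Phase d)} [IsProbabilityMeasure μ] {N : ℝ} (h : PB μ N) :
    0 ≤ N := by
  obtain ⟨z, hz⟩ := h.exists
  exact (en_nonneg z).trans hz

lemma st_uc : UniformContinuous Real.smoothTransition := by
  have h : Real.smoothTransition = (fun y : Icc (0:ℝ) 1 => Real.smoothTransition y) ∘
      (projIcc (0:ℝ) 1 zero_le_one) := by
    ext x
    exact (Real.smoothTransition.projIcc).symm
  rw [h]
  refine UniformContinuous.comp (CompactSpace.uniformContinuous_of_continuous (by fun_prop)) ?_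
  exact (LipschitzWith.projIcc zero_le_one).uniformContinuous

lemma st_diff : Differentiable ℝ Real.smoothTransition :=
  (Real.smoothTransition.contDiff (n := 1)).differentiable (by norm_num)

lemma st_deriv_cont : Continuous (deriv Real.smoothTransition) :=
  (Real.smoothTransition.contDiff (n := 1)).continuous_deriv (by norm_num)

lemma st_deriv_nonneg (x : ℝ) : 0 ≤ deriv Real.smoothTransition x :=
  Real.smoothTransition.monotone.deriv_nonneg

def gg {d : ℕ} (r β t0 : ℝ) (z : Phase d) (t : ℝ) : ℝ :=
  Real.smoothTransition (r + 1 - en z + β * (t - t0))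

lemma gg_int {d : ℕ} (r β t0 t : ℝ) (μ : Measure (Phase d)) [IsProbabilityMeasure μ] :
    Integrable (fun z => gg r β t0 z t) μ := by
  refine Integrable.of_bound (C := 1) ?_ ?_
  · apply Continuous.aestronglyMeasurable
    unfold gg
    have := en_cont (d := d)
    fun_prop
  · filter_upwards with z
    rw [gg, Real.norm_of_nonneg (Real.smoothTransition.nonneg _)]
    exact Real.smoothTransition.le_one _

lemma gg_le {d : ℕ} (r β t0 t : ℝ) (μ : Measure (Phase d)) [IsProbabilityMeasure μ] :
    ∫ z, gg r β t0 z t ∂μ ≤ 1 := by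
  have := integral_mono (gg_int r β t0 t μ) (integrable_const (1:ℝ))
    (fun z => Real.smoothTransition.le_one _)
  simpa using this

lemma gg_one_iff {d : ℕ} (r β t0 t : ℝ) (μ : Measure (Phase d)) [IsProbabilityMeasure μ] :
    ∫ z, gg r β t0 z t ∂μ = 1 ↔ PB μ (r + β * (t - t0)) := by
  have h1 : ∫ z, (1 - gg r β t0 z t) ∂μ = 1 - ∫ z, gg r β t0 z t ∂μ := by
    rw [integral_sub (integrable_const _) (gg_int r β t0 t μ)]; simp
  have h2 := integral_eq_zero_iff_of_nonneg_ae (μ := μ) (f := fun z => 1 - gg r β t0 z t)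
    (Eventually.of_forall fun z => sub_nonneg.2 (Real.smoothTransition.le_one _))
    ((integrable_const _).sub (gg_int r β t0 t μ))
  rw [h1] at h2
  rw [show (∫ z, gg r β t0 z t ∂μ = 1) ↔ (1 - ∫ z, gg r β t0 z t ∂μ = 0) by
    constructor <;> intro h <;> linarith, h2]
  unfold PB
  refine Filter.eventually_congr (Eventually.of_forall fun z => ?_)
  simp only [Pi.zero_apply, gg]
  rw [sub_eq_zero, eq_comm, Real.smoothTransition.eq_one_iff_one_le]
  constructor <;> intro h <;> linarith

lemma en_bdd_compact {d : ℕ} (c : ℝ) : IsCompact {z : Phase d | en z ≤ c} := by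
  refine Metric.isCompact_of_isClosed_isBounded (isClosed_le en_cont continuous_const) ?_
  refine (Metric.isBounded_closedBall (x := (0 : Phase d)) (r := c + 1)).subset ?_
  intro z hz
  have hz' : ‖z.1‖ ^ 2 + ‖z.2‖ ^ 2 ≤ c := hz
  rw [mem_closedBall_zero_iff, Prod.norm_def]
  refine max_le ?_ ?_
  · nlinarith [sq_nonneg (‖z.1‖ - 1), sq_nonneg (‖z.2‖)]
  · nlinarith [sq_nonneg (‖z.2‖ - 1), sq_nonneg (‖z.1‖)]

/-- time continuity of the tested quantity -/
lemma hh_cont {d : ℕ} {T : ℝ} {μ : ℝ → Measure (Phase d)}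
    (hc : ∀ g : ZeroAtInftyContinuousMap (Phase d) ℝ,
      ContinuousOn (fun t => ∫ z, g z ∂(μ t)) (Ico 0 T))
    (hprob : ∀ t ∈ Set.Ico (0:ℝ) T, IsProbabilityMeasure (μ t)) (r β t0 : ℝ) :
    ContinuousOn (fun t => ∫ z, gg r β t0 z t ∂(μ t)) (Ico 0 T) := by
  intro t ht
  have hcs : HasCompactSupport (fun z : Phase d => gg r β t0 z t) := by
    refine HasCompactSupport.of_support_subset_isCompact
      (en_bdd_compact (r + 1 + β * (t - t0))) ?_
    intro z hz
    simp only [mem_ofPred_eq]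
    by_contra hcon
    push Not at hcon
    apply hz
    exact Real.smoothTransition.zero_of_nonpos (by linarith)
  have hcont : Continuous (fun z : Phase d => gg r β t0 z t) := by
    unfold gg
    have := en_cont (d := d)
    fun_prop
  let G : ZeroAtInftyContinuousMap (Phase d) ℝ :=
    ⟨⟨fun z => gg r β t0 z t, hcont⟩, hcs.is_zero_at_infty⟩
  have hG : ContinuousWithinAt (fun s => ∫ z, gg r β t0 z t ∂(μ s)) (Ico 0 T) t := hc G t ht
  rw [Metric.continuousWithinAt_iff'] at hG ⊢
  intro ε hε
  obtain ⟨δ, hδ, hδ'⟩ := Metric.uniformContinuous_iff.1 st_uc (ε/2) (by positivity)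
  have hb : ∀ᶠ s in nhdsWithin t (Ico 0 T), |β * (s - t)| < δ := by
    have : ContinuousWithinAt (fun s => |β * (s - t)|) (Ico 0 T) t := by fun_prop
    refine this.eventually_lt continuousWithinAt_const ?_
    simpa using hδ
  filter_upwards [hG (ε/2) (by positivity), hb, self_mem_nhdsWithin] with s h1 h2 h3
  have := hprob s h3
  have h4 : dist (∫ z, gg r β t0 z s ∂(μ s)) (∫ z, gg r β t0 z t ∂(μ s)) ≤ ε/2 := by
    rw [dist_eq_norm, ← integral_sub (gg_int r β t0 s _) (gg_int r β t0 t _)]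
    refine (norm_integral_le_of_norm_le_const (C := ε/2) ?_).trans (by simp)
    filter_upwards with z
    rw [← dist_eq_norm]
    refine (hδ' ?_).le
    rw [Real.dist_eq]
    convert h2 using 2
    ring
  calc _ ≤ _ := dist_triangle _ _ _
    _ < ε := by linarith

lemma herdQ_bound {d : ℕ} {φ : ℝ → ℝ} {φM : ℝ} (hφ : ∀ r, 0 ≤ φ r ∧ φ r ≤ φM)
    (μ : Measure (Phase d)) [IsProbabilityMeasure μ] {N : ℝ} (h : PB μ N) (x v : Euc d) :
    ‖herdQ 1 1 1 φ μ x v‖ ≤ (1 + φM) * (√N + ‖x‖) + φM * (√N + ‖v‖) := by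
  unfold herdQ
  refine (norm_integral_le_of_norm_le_const
    (C := (1 + φM) * (√N + ‖x‖) + φM * (√N + ‖v‖)) ?_).trans (by simp)
  filter_upwards [h] with z hz
  have hz' : ‖z.1‖ ^ 2 + ‖z.2‖ ^ 2 ≤ N := hz
  have h1 : ‖z.1‖ ≤ √N := Real.le_sqrt_of_sq_le (by nlinarith [sq_nonneg ‖z.2‖])
  have h2 : ‖z.2‖ ≤ √N := Real.le_sqrt_of_sq_le (by nlinarith [sq_nonneg ‖z.1‖])
  obtain ⟨hp, hp'⟩ := hφ ‖x - z.1‖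
  have h3 : ‖z.1 - x‖ ≤ √N + ‖x‖ := (norm_sub_le _ _).trans (by linarith)
  have h4 : ‖z.2 - v‖ ≤ √N + ‖v‖ := (norm_sub_le _ _).trans (by linarith)
  simp only [one_mul, one_smul]
  refine (norm_add₃_le).trans ?_
  rw [norm_smul, norm_smul, Real.norm_of_nonneg hp]
  have h5 : φ ‖x - z.1‖ * ‖z.1 - x‖ ≤ φM * (√N + ‖x‖) := by gcongr; linarith
  have h6 : φ ‖x - z.1‖ * ‖z.2 - v‖ ≤ φM * (√N + ‖v‖) := by gcongr; linarith
  linarith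

lemma herdQ_meas {d : ℕ} {φ : ℝ → ℝ} (hφ : Continuous φ)
    (μ : Measure (Phase d)) [IsProbabilityMeasure μ] :
    StronglyMeasurable (fun z : Phase d => herdQ 1 1 1 φ μ z.1 z.2) := by
  unfold herdQ
  refine StronglyMeasurable.integral_prod_right (f := fun (y : Phase d) (z : Phase d) =>
    ((1:ℝ) • (z.1 - y.1) + (1 * φ ‖y.1 - z.1‖) • (z.1 - y.1)
      + (1 * φ ‖y.1 - z.1‖) • (z.2 - y.2))) ?_
  apply Continuous.stronglyMeasurable
  simp only [Function.uncurry_def]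
  fun_prop

/-- the dissipation along the flow -/
def LEn {d : ℕ} (φ : ℝ → ℝ) (μ : Measure (Phase d)) (z : Phase d) : ℝ :=
  2 * inner ℝ z.1 z.2 + 2 * inner ℝ z.2 (herdQ 1 1 1 φ μ z.1 z.2)

lemma LEn_bound {d : ℕ} {φ : ℝ → ℝ} {φM : ℝ} (hφ : ∀ r, 0 ≤ φ r ∧ φ r ≤ φM)
    (μ : Measure (Phase d)) [IsProbabilityMeasure μ] {N : ℝ} (h : PB μ N) :
    ∀ᵐ z ∂μ, |LEn φ μ z| ≤ (6 + 8 * φM) * N := by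
  have hN := h.nonneg
  filter_upwards [h] with z hz
  have hz' : ‖z.1‖ ^ 2 + ‖z.2‖ ^ 2 ≤ N := hz
  have h1 : ‖z.1‖ ≤ √N := Real.le_sqrt_of_sq_le (by nlinarith [sq_nonneg ‖z.2‖])
  have h2 : ‖z.2‖ ≤ √N := Real.le_sqrt_of_sq_le (by nlinarith [sq_nonneg ‖z.1‖])
  have hM : 0 ≤ φM := (hφ 0).1.trans (hφ 0).2
  have hQ : ‖herdQ 1 1 1 φ μ z.1 z.2‖ ≤ (2 + 4 * φM) * √N := by
    refine (herdQ_bound hφ μ h z.1 z.2).trans ?_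
    have := mul_le_mul_of_nonneg_left h1 (by linarith : 0 ≤ 1 + φM)
    have := mul_le_mul_of_nonneg_left h2 hM
    linarith
  have e := Real.mul_self_sqrt hN
  have a1 : |inner ℝ z.1 z.2| ≤ N := by
    refine (abs_real_inner_le_norm _ _).trans ?_
    rw [← e]; gcongr
  have a2 : |inner ℝ z.2 (herdQ 1 1 1 φ μ z.1 z.2)| ≤ (2 + 4 * φM) * N := by
    refine (abs_real_inner_le_norm _ _).trans ?_
    have : ‖z.2‖ * ‖herdQ 1 1 1 φ μ z.1 z.2‖ ≤ √N * ((2 + 4 * φM) * √N) := by gcongr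
    calc _ ≤ _ := this
      _ = (2 + 4 * φM) * (√N * √N) := by ring
      _ = _ := by rw [e]
  unfold LEn
  rw [abs_le] at *
  constructor <;> linarith [a1.1, a1.2, a2.1, a2.2]

lemma step {d : ℕ} {T : ℝ} {φ : ℝ → ℝ} (hφc : Continuous φ) {φM : ℝ}
    (hφ : ∀ r, 0 ≤ φ r ∧ φ r ≤ φM)
    {μ : ℝ → Measure (Phase d)}
    (hsol : IsMVSol 1 1 1 φ (Set.Ico 0 T) μ)
    (hprob : ∀ t ∈ Set.Ico (0:ℝ) T, IsProbabilityMeasure (μ t))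
    (c β t0 r p δ t m N : ℝ) (hp : 0 ≤ p) (hδ : 0 < δ) (hpt : p + δ ≤ t) (htT : t < T)
    (hN : ∀ s ∈ Icc p t, PB (μ s) N)
    (hc : ∀ s ∈ Icc p t, ∀ᵐ z ∂(μ s), 0 ≤ c * (β - LEn φ (μ s) z))
    (hm : ∀ s ∈ Icc p (p + δ), c * m ≤ c * ∫ z, gg r β t0 z s ∂(μ s))
    (hne : ∫ z, gg r β t0 z t ∂(μ t) ≠ 0) :
    c * m ≤ c * ∫ z, gg r β t0 z t ∂(μ t) := by
  set χ0 : ℝ → ℝ := fun s => Real.smoothTransition ((s - p) / δ) with hχ0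
  set χ : ℝ → ℝ := fun s => χ0 s * Real.smoothTransition (t + 2 - s) with hχ
  have hst : ContDiff ℝ 1 Real.smoothTransition := Real.smoothTransition.contDiff (n := 1)
  have hχ0C : ContDiff ℝ 1 χ0 := hst.comp (by fun_prop)
  have hχC : ContDiff ℝ 1 χ := hχ0C.mul (hst.comp (by fun_prop))
  have hχeq : ∀ s ≤ t, χ s = χ0 s := fun s hs => by
    simp only [hχ]; rw [Real.smoothTransition.one_of_one_le (by linarith), mul_one]
  have hχd : ∀ s ≤ t, deriv χ s = deriv χ0 s := fun s hs => by
    apply Filter.EventuallyEq.deriv_eq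
    filter_upwards [Iio_mem_nhds (show s < t + 1 by linarith)] with u hu
    have : u < t + 1 := hu
    simp only [hχ]; rw [Real.smoothTransition.one_of_one_le (by linarith), mul_one]
  have hχ0m : Monotone χ0 := by
    intro a b hab
    apply Real.smoothTransition.monotone
    gcongr
  have hχ0z : ∀ s ≤ p, χ0 s = 0 := fun s hs =>
    Real.smoothTransition.zero_of_nonpos (div_nonpos_of_nonpos_of_nonneg (by linarith) hδ.le)
  have hχ0o : ∀ s, p + δ ≤ s → χ0 s = 1 := fun s hs =>
    Real.smoothTransition.one_of_one_le ((one_le_div hδ).2 (by linarith))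
  have hd1 : ∀ s < p, deriv χ0 s = 0 := fun s hs => by
    have : χ0 =ᶠ[nhds s] fun _ => 0 := by
      filter_upwards [Iio_mem_nhds hs] with u hu using hχ0z u (le_of_lt hu)
    rw [this.deriv_eq]; simp
  have hd2 : ∀ s, p + δ < s → deriv χ0 s = 0 := fun s hs => by
    have : χ0 =ᶠ[nhds s] fun _ => 1 := by
      filter_upwards [Ioi_mem_nhds hs] with u hu using hχ0o u (le_of_lt hu)
    rw [this.deriv_eq]; simp
  set G : Phase d × ℝ → ℝ := fun y => χ y.2 * gg r β t0 y.1 y.2 with hG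
  have hGC : ContDiff ℝ 1 G := by
    refine (hχC.comp contDiff_snd).mul ?_
    refine hst.comp ?_
    have h1 : ContDiff ℝ 1 (fun y : Phase d × ℝ => ‖y.1.1‖ ^ 2) :=
      (contDiff_fst.comp contDiff_fst).norm_sq ℝ
    have h2 : ContDiff ℝ 1 (fun y : Phase d × ℝ => ‖y.1.2‖ ^ 2) :=
      (contDiff_snd.comp contDiff_fst).norm_sq ℝ
    unfold en
    fun_prop
  have hGS : HasCompactSupport G := by
    refine HasCompactSupport.of_support_subset_isCompact
      ((en_bdd_compact (d := d) (r + 1 + |β| * (t + 2 + |t0|))).prod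
        (isCompact_Icc (a := p) (b := t + 2))) ?_
    rintro ⟨z, s⟩ hz
    have hz' : χ0 s * Real.smoothTransition (t + 2 - s) * gg r β t0 z s ≠ 0 := hz
    have z1 := left_ne_zero_of_mul (left_ne_zero_of_mul hz')
    have z2 := right_ne_zero_of_mul (left_ne_zero_of_mul hz')
    have z3 := right_ne_zero_of_mul hz'
    have y1 : p < s := by
      by_contra h; exact z1 (hχ0z s (not_lt.1 h))
    have y2 : s < t + 2 := by
      by_contra h; exact z2 (Real.smoothTransition.zero_of_nonpos (by linarith [not_lt.1 h]))
    have y3 : 0 < r + 1 - en z + β * (s - t0) := by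
      by_contra h; exact z3 (Real.smoothTransition.zero_of_nonpos (not_lt.1 h))
    refine ⟨?_, y1.le, y2.le⟩
    show en z ≤ _
    have : β * (s - t0) ≤ |β| * (t + 2 + |t0|) := by
      refine (le_abs_self _).trans ?_
      rw [abs_mul]
      gcongr
      rw [abs_le]
      constructor <;> linarith [neg_abs_le t0, le_abs_self t0]
    linarith
  have hw := hsol.2.2 G hGC hGS t ⟨by linarith, htT⟩
  -- compute the integrand
  have hptw : ∀ s (z : Phase d), (deriv (fun u => G (z, u)) s
          + (fderiv ℝ (fun y => G ((y, z.2), s)) z.1) z.2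
          + (fderiv ℝ (fun w => G ((z.1, w), s)) z.2)
              (herdQ 1 1 1 φ (μ s) z.1 z.2)) =
      deriv χ s * gg r β t0 z s + χ s * (deriv Real.smoothTransition
        (r + 1 - en z + β * (s - t0)) * (β - LEn φ (μ s) z)) := by
    intro s z
    have hS := (st_diff (r + 1 - en z + β * (s - t0))).hasDerivAt
    have e1 : HasDerivAt (fun u => G (z, u)) (deriv χ s * gg r β t0 z s + χ s *
        (deriv Real.smoothTransition (r + 1 - en z + β * (s - t0)) * β)) s := by
      have hc1 := ((hχC.differentiable (by norm_num)) s).hasDerivAt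
      have hi : HasDerivAt (fun u => r + 1 - en z + β * (u - t0)) β s := by
        simpa using (((hasDerivAt_id s).sub_const t0).const_mul β).const_add (r + 1 - en z)
      exact hc1.mul (hS.comp s hi)
    have e2 : HasFDerivAt (fun y => G ((y, z.2), s)) ((χ s *
        (deriv Real.smoothTransition (r + 1 - en z + β * (s - t0)))) •
          (-((2:ℕ) • innerSL ℝ z.1) : Euc d →L[ℝ] ℝ)) z.1 := by
      have hi : HasFDerivAt (fun y => r + 1 - en (y, z.2) + β * (s - t0))
          (-((2:ℕ) • innerSL ℝ z.1) : Euc d →L[ℝ] ℝ) z.1 := by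
        have := (((hasStrictFDerivAt_norm_sq z.1).hasFDerivAt.add_const (‖z.2‖^2)).const_sub
          (r + 1)).add_const (β * (s - t0))
        exact this
      have := (hS.comp_hasFDerivAt z.1 hi).const_mul (χ s)
      rw [smul_smul] at this
      exact this
    have e3 : HasFDerivAt (fun w => G ((z.1, w), s)) ((χ s *
        (deriv Real.smoothTransition (r + 1 - en z + β * (s - t0)))) •
          (-((2:ℕ) • innerSL ℝ z.2) : Euc d →L[ℝ] ℝ)) z.2 := by
      have hi : HasFDerivAt (fun w => r + 1 - en (z.1, w) + β * (s - t0))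
          (-((2:ℕ) • innerSL ℝ z.2) : Euc d →L[ℝ] ℝ) z.2 := by
        have := (((hasStrictFDerivAt_norm_sq z.2).hasFDerivAt.const_add (‖z.1‖^2)).const_sub
          (r + 1)).add_const (β * (s - t0))
        exact this
      have := (hS.comp_hasFDerivAt z.2 hi).const_mul (χ s)
      rw [smul_smul] at this
      exact this
    rw [e1.deriv, e2.fderiv, e3.fderiv]
    simp only [FunLike.coe_smul, FunLike.coe_neg, Pi.smul_apply, Pi.neg_apply, two_nsmul,
      FunLike.coe_add, Pi.add_apply, innerSL_apply_apply, smul_eq_mul, LEn]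
    ring
  simp only [hptw] at hw
  have hG0 : ∀ z, G (z, 0) = 0 := fun z => by
    simp only [hG, hχ]; rw [hχ0z 0 hp]; simp
  have hGt : ∀ z, G (z, t) = gg r β t0 z t := fun z => by
    simp only [hG]; rw [hχeq t le_rfl, hχ0o t hpt, one_mul]
  simp only [hG0, hGt, integral_zero, sub_zero] at hw
  set D : ℝ → ℝ := fun s => ∫ z, (deriv χ s * gg r β t0 z s + χ s * (deriv Real.smoothTransition
        (r + 1 - en z + β * (s - t0)) * (β - LEn φ (μ s) z))) ∂(μ s) with hD
  have hDint : IntervalIntegrable D volume 0 t := by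
    by_contra hcon
    exact hne (hw.trans (intervalIntegral.integral_undef hcon))
  have ht0 : 0 ≤ t := by linarith
  have hlow : ∀ s ∈ Icc 0 t, (c * m) * deriv χ s ≤ c * D s := by
    rintro s ⟨hs0, hst'⟩
    rcases lt_or_ge s p with hsp | hsp
    · have a : deriv χ s = 0 := by rw [hχd s hst', hd1 s hsp]
      have b : χ s = 0 := by rw [hχeq s hst', hχ0z s hsp.le]
      simp [hD, a, b]
    · have hsT : s ∈ Ico 0 T := ⟨hs0, by linarith⟩
      have := hprob s hsT
      have hPs := hN s ⟨hsp, hst'⟩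
      have hbd := LEn_bound hφ (μ s) hPs
      have hint : Integrable (fun z => deriv Real.smoothTransition
        (r + 1 - en z + β * (s - t0)) * (β - LEn φ (μ s) z)) (μ s) := by
        obtain ⟨B, hB⟩ := (isCompact_Icc (a := r + 1 - N + β * (s - t0))
          (b := r + 1 + β * (s - t0))).exists_bound_of_continuousOn
          st_deriv_cont.continuousOn
        refine Integrable.of_bound (C := B * (|β| + (6 + 8 * φM) * N)) ?_ ?_
        · refine AEStronglyMeasurable.mul ?_ ?_
          · apply Continuous.aestronglyMeasurable
            refine st_deriv_cont.comp ?_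
            have := en_cont (d := d)
            fun_prop
          · refine aestronglyMeasurable_const.sub ?_
            unfold LEn
            refine AEStronglyMeasurable.add ?_ ?_
            · apply Continuous.aestronglyMeasurable
              fun_prop
            · refine AEStronglyMeasurable.const_mul ?_ 2
              exact (continuous_snd.aestronglyMeasurable).inner
                (herdQ_meas hφc (μ s)).aestronglyMeasurable
        · filter_upwards [hPs, hbd] with z hz1 hz2
          rw [norm_mul]
          have hb1 := hB (r + 1 - en z + β * (s - t0)) ⟨by linarith, by linarith [en_nonneg z]⟩
          have hb2 : ‖β - LEn φ (μ s) z‖ ≤ |β| + (6 + 8 * φM) * N :=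
            (norm_sub_le _ _).trans (add_le_add le_rfl hz2)
          exact mul_le_mul hb1 hb2 (norm_nonneg _) ((norm_nonneg _).trans hb1)
      have hDs : D s = deriv χ s * (∫ z, gg r β t0 z s ∂(μ s)) + χ s *
          ∫ z, deriv Real.smoothTransition
            (r + 1 - en z + β * (s - t0)) * (β - LEn φ (μ s) z) ∂(μ s) := by
        simp only [hD]
        rw [integral_add ((gg_int r β t0 s (μ s)).const_mul _) (hint.const_mul _),
          integral_const_mul, integral_const_mul]
      have hpos : 0 ≤ c * ∫ z, deriv Real.smoothTransition
            (r + 1 - en z + β * (s - t0)) * (β - LEn φ (μ s) z) ∂(μ s) := by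
        rw [← integral_const_mul]
        apply integral_nonneg_of_ae
        filter_upwards [hc s ⟨hsp, hst'⟩] with z hz
        simp only [Pi.zero_apply]
        rw [mul_left_comm]
        exact mul_nonneg (st_deriv_nonneg _) hz
      have hχp : 0 ≤ χ s := by
        rw [hχeq s hst']; exact Real.smoothTransition.nonneg _
      have hfirst : (c * m) * deriv χ s ≤ deriv χ s * (c * ∫ z, gg r β t0 z s ∂(μ s)) := by
        rw [hχd s hst']
        rcases le_or_gt s (p + δ) with h | h
        · rw [mul_comm]
          exact mul_le_mul_of_nonneg_left (hm s ⟨hsp, h⟩) hχ0m.deriv_nonneg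
        · rw [hd2 s h]; simp
      rw [hDs]
      have := mul_nonneg hχp hpos
      linarith
  have hχint : IntervalIntegrable (deriv χ) volume 0 t :=
    (hχC.continuous_deriv (by norm_num)).intervalIntegrable _ _
  have hI := intervalIntegral.integral_mono_on ht0 (hχint.const_mul (c * m)) (hDint.const_mul c) hlow
  rw [intervalIntegral.integral_const_mul, intervalIntegral.integral_const_mul, ← hw,
    intervalIntegral.integral_deriv_eq_sub (fun x _ => (hχC.differentiable (by norm_num)) x) hχint,
    hχeq t le_rfl, hχ0o t hpt, hχeq 0 ht0, hχ0z 0 hp] at hI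
  linarith

lemma step_lim {d : ℕ} {T : ℝ} {φ : ℝ → ℝ} (hφc : Continuous φ) {φM : ℝ}
    (hφ : ∀ r, 0 ≤ φ r ∧ φ r ≤ φM)
    {μ : ℝ → Measure (Phase d)}
    (hsol : IsMVSol 1 1 1 φ (Set.Ico 0 T) μ)
    (hprob : ∀ t ∈ Set.Ico (0:ℝ) T, IsProbabilityMeasure (μ t))
    (c β t0 r p t N : ℝ) (hp : 0 ≤ p) (hpt : p ≤ t) (htT : t < T)
    (hN : ∀ s ∈ Icc p t, PB (μ s) N)
    (hc : ∀ s ∈ Icc p t, ∀ᵐ z ∂(μ s), 0 ≤ c * (β - LEn φ (μ s) z))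
    (hne : ∫ z, gg r β t0 z t ∂(μ t) ≠ 0) :
    c * (∫ z, gg r β t0 z p ∂(μ p)) ≤ c * ∫ z, gg r β t0 z t ∂(μ t) := by
  rcases hpt.eq_or_lt with rfl | hlt
  · exact le_rfl
  by_contra! hcon
  set h : ℝ → ℝ := fun s => ∫ z, gg r β t0 z s ∂(μ s) with hh
  change c * h t < c * h p at hcon
  have hcont : ContinuousOn h (Ico 0 T) := hh_cont hsol.2.1 hprob r β t0
  have hcp : ContinuousWithinAt (fun s => c * h s) (Ico 0 T) p :=
    (hcont p ⟨hp, by linarith⟩).const_mul c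
  have hev := hcp.eventually (lt_mem_nhds (show c * ((h p + h t) / 2) < c * h p by linarith))
  rw [eventually_nhdsWithin_iff, Metric.eventually_nhds_iff] at hev
  obtain ⟨ε, hε, hev⟩ := hev
  have hmin : 0 < min (ε / 2) (t - p) := lt_min (by linarith) (by linarith)
  have := step hφc hφ hsol hprob c β t0 r p (min (ε / 2) (t - p)) t ((h p + h t) / 2) N hp hmin
    (by linarith [min_le_right (ε / 2) (t - p)]) htT hN hc (by
      rintro s ⟨hs1, hs2⟩
      have a1 := min_le_left (ε / 2) (t - p)
      have a2 := min_le_right (ε / 2) (t - p)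
      refine (hev ?_ ⟨by linarith, by linarith⟩).le
      rw [Real.dist_eq, abs_of_nonneg (by linarith)]
      linarith) hne
  change _ ≤ c * h t at this
  linarith

lemma prop_fwd {d : ℕ} {T : ℝ} {φ : ℝ → ℝ} (hφc : Continuous φ) {φM : ℝ}
    (hφ : ∀ r, 0 ≤ φ r ∧ φ r ≤ φM)
    {μ : ℝ → Measure (Phase d)}
    (hsol : IsMVSol 1 1 1 φ (Set.Ico 0 T) μ)
    (hprob : ∀ t ∈ Set.Ico (0:ℝ) T, IsProbabilityMeasure (μ t))
    (r p q N : ℝ) (hp : 0 ≤ p) (hpq : p ≤ q) (hqT : q < T)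
    (hN : ∀ s ∈ Icc p q, PB (μ s) N) (hr : PB (μ p) r) :
    PB (μ q) (r + (6 + 8 * φM) * N * (q - p)) := by
  set κ := (6 + 8 * φM) * N with hκ
  have key : ∀ t ∈ Icc p q, ∫ z, gg r κ p z t ∂(μ t) ≠ 0 → 1 ≤ ∫ z, gg r κ p z t ∂(μ t) := by
    rintro t ⟨ht1, ht2⟩ hne
    have := hprob p ⟨hp, by linarith⟩
    have h1 : ∫ z, gg r κ p z p ∂(μ p) = 1 := by
      rw [gg_one_iff]; simpa using hr
    have h2 := step_lim hφc hφ hsol hprob 1 κ p r p t N hp ht1 (by linarith)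
      (fun s hs => hN s ⟨hs.1, hs.2.trans ht2⟩) (by
        rintro s ⟨hs1, hs2⟩
        have := hprob s ⟨by linarith, by linarith⟩
        filter_upwards [LEn_bound hφ (μ s) (hN s ⟨hs1, by linarith⟩)] with z hz
        linarith [(abs_le.1 hz).2]) hne
    rw [h1] at h2
    linarith
  have := hprob q ⟨by linarith, hqT⟩
  rw [← gg_one_iff]
  refine le_antisymm (gg_le _ _ _ _ _) (key q ⟨hpq, le_rfl⟩ ?_)
  intro hq0
  have hcont : ContinuousOn (fun t => ∫ z, gg r κ p z t ∂(μ t)) (Icc p q) :=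
    (hh_cont hsol.2.1 hprob r κ p).mono (fun s hs => ⟨hp.trans hs.1, hs.2.trans_lt hqT⟩)
  have h1 : ∫ z, gg r κ p z p ∂(μ p) = 1 := by
    have := hprob p ⟨hp, by linarith⟩
    rw [gg_one_iff]; simpa using hr
  obtain ⟨t, ht, hte⟩ := intermediate_value_Icc' hpq hcont
    (show (1/2 : ℝ) ∈ _ by simp only [hq0, h1]; constructor <;> norm_num)
  simp only at hte
  have := key t ht (by rw [hte]; norm_num)
  rw [hte] at this
  norm_num at this

lemma prop_bwd {d : ℕ} {T : ℝ} {φ : ℝ → ℝ} (hφc : Continuous φ) {φM : ℝ}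
    (hφ : ∀ r, 0 ≤ φ r ∧ φ r ≤ φM)
    {μ : ℝ → Measure (Phase d)}
    (hsol : IsMVSol 1 1 1 φ (Set.Ico 0 T) μ)
    (hprob : ∀ t ∈ Set.Ico (0:ℝ) T, IsProbabilityMeasure (μ t))
    (r p q N : ℝ) (hp : 0 ≤ p) (hpq : p ≤ q) (hqT : q < T)
    (hN : ∀ s ∈ Icc p q, PB (μ s) N) (hr : PB (μ q) r) :
    PB (μ p) (r + (6 + 8 * φM) * N * (q - p)) := by
  set κ := (6 + 8 * φM) * N with hκ
  have := hprob p ⟨hp, by linarith⟩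
  have := hprob q ⟨by linarith, hqT⟩
  have h1 : ∫ z, gg r (-κ) q z q ∂(μ q) = 1 := by
    rw [gg_one_iff]; simpa using hr
  have h2 := step_lim hφc hφ hsol hprob (-1) (-κ) q r p q N hp hpq hqT hN (by
        rintro s ⟨hs1, hs2⟩
        have := hprob s ⟨by linarith, by linarith⟩
        filter_upwards [LEn_bound hφ (μ s) (hN s ⟨hs1, by linarith⟩)] with z hz
        linarith [(abs_le.1 hz).1]) (by rw [h1]; norm_num)
  rw [h1] at h2
  have h3 := (gg_one_iff r (-κ) q p (μ p)).1 (le_antisymm (gg_le _ _ _ _ _) (by linarith))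
  convert h3 using 1
  ring

lemma dbl {d : ℕ} {T : ℝ} {φ : ℝ → ℝ} (hφc : Continuous φ) {φM : ℝ}
    (hφ : ∀ r, 0 ≤ φ r ∧ φ r ≤ φM)
    {μ : ℝ → Measure (Phase d)}
    (hsol : IsMVSol 1 1 1 φ (Set.Ico 0 T) μ)
    (hprob : ∀ t ∈ Set.Ico (0:ℝ) T, IsProbabilityMeasure (μ t))
    (r p q N a : ℝ) (hp : 0 ≤ p) (hqT : q < T) (hK : (6 + 8 * φM) * (q - p) ≤ 1 / 2)
    (hN : ∀ s ∈ Icc p q, PB (μ s) N) (ha : a ∈ Icc p q) (hr : PB (μ a) r) :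
    ∀ t ∈ Icc p q, PB (μ t) (2 * r) := by
  have hM : 0 ≤ φM := (hφ 0).1.trans (hφ 0).2
  have one : ∀ N', (∀ s ∈ Icc p q, PB (μ s) N') → ∀ s ∈ Icc p q, PB (μ s) (r + N' / 2) := by
    intro N' hN' s hs
    have hN0 : 0 ≤ N' := by
      have := hprob a ⟨hp.trans ha.1, ha.2.trans_lt hqT⟩
      exact (hN' a ha).nonneg
    rcases le_total a s with h | h
    · refine (prop_fwd hφc hφ hsol hprob r a s N' (hp.trans ha.1) h (hs.2.trans_lt hqT)
        (fun u hu => hN' u ⟨ha.1.trans hu.1, hu.2.trans hs.2⟩) hr).mono ?_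
      have : (6 + 8 * φM) * (s - a) ≤ (6 + 8 * φM) * (q - p) := by
        gcongr
        · exact hs.2
        · exact ha.1
      nlinarith
    · refine (prop_bwd hφc hφ hsol hprob r s a N' (hp.trans hs.1) h (ha.2.trans_lt hqT)
        (fun u hu => hN' u ⟨hs.1.trans hu.1, hu.2.trans ha.2⟩) hr).mono ?_
      have : (6 + 8 * φM) * (a - s) ≤ (6 + 8 * φM) * (q - p) := by
        gcongr
        · exact ha.2
        · exact hs.1
      nlinarith
  have hr0 : 0 ≤ r := by
    have := hprob a ⟨hp.trans ha.1, ha.2.trans_lt hqT⟩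
    exact hr.nonneg
  have all : ∀ n : ℕ, ∀ s ∈ Icc p q, PB (μ s) (2 * r + N * (1 / 2) ^ n) := by
    intro n
    induction n with
    | zero => intro s hs; exact (hN s hs).mono (by simp; linarith)
    | succ k ih =>
      intro s hs
      refine (one _ ih s hs).mono (le_of_eq ?_)
      rw [pow_succ]; ring
  intro t ht
  have h := ae_all_iff.2 (fun n => all n t ht)
  unfold PB
  filter_upwards [h] with z hz
  have hlim : Tendsto (fun n : ℕ => 2 * r + N * (1 / 2 : ℝ) ^ n) atTop (nhds (2 * r + N * 0)) :=
    ((tendsto_pow_atTop_nhds_zero_of_lt_one (by norm_num) (by norm_num)).const_mul N).const_add _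
  have := ge_of_tendsto' hlim hz
  linarith

lemma PB_closed {d : ℕ} {T : ℝ} {φ : ℝ → ℝ} {μ : ℝ → Measure (Phase d)}
    (hsol : IsMVSol 1 1 1 φ (Set.Ico 0 T) μ)
    (hprob : ∀ t ∈ Set.Ico (0:ℝ) T, IsProbabilityMeasure (μ t)) (N : ℝ)
    {F : Set ℝ} (hF : F ⊆ Ico 0 T) : IsClosed {s : F | PB (μ s) N} := by
  have hc : Continuous (fun s : F => ∫ z, gg N 0 0 z s ∂(μ s)) :=
    continuousOn_iff_continuous_restrict.1 ((hh_cont hsol.2.1 hprob N 0 0).mono hF)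
  convert! isClosed_eq hc (continuous_const (y := (1:ℝ))) using 1
  ext s
  have := hprob s (hF s.2)
  simp [gg_one_iff]

lemma loc_bdd {d : ℕ} {T : ℝ} {φ : ℝ → ℝ} (hφc : Continuous φ) {φM : ℝ}
    (hφ : ∀ r, 0 ≤ φ r ∧ φ r ≤ φM)
    {μ : ℝ → Measure (Phase d)}
    (hsol : IsMVSol 1 1 1 φ (Set.Ico 0 T) μ)
    (hprob : ∀ t ∈ Set.Ico (0:ℝ) T, IsProbabilityMeasure (μ t))
    (hcpt : ∀ t ∈ Set.Ico (0:ℝ) T, ∃ N, PB (μ t) N) (t1 : ℝ) (ht1 : t1 < T) :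
    ∃ N, ∀ s ∈ Icc 0 t1, PB (μ s) N := by
  have hM : 0 ≤ φM := (hφ 0).1.trans (hφ 0).2
  set F : Set ℝ := {s | s ∈ Icc 0 t1 ∧ ∀ N, ∀ ε > 0, ∃ s' ∈ Icc 0 t1, |s' - s| < ε ∧ ¬ PB (μ s') N}
    with hFdef
  have hFT : F ⊆ Ico 0 T := fun s hs => ⟨hs.1.1, hs.1.2.trans_lt ht1⟩
  -- compactness
  have hcomp : ∀ a b, Icc a b ⊆ Icc 0 t1 → (∀ s ∈ Icc a b, s ∉ F) →
      ∃ N, ∀ s ∈ Icc a b, PB (μ s) N := by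
    intro a b hab hnF
    refine (isCompact_Icc (a := a) (b := b)).induction_on
      (p := fun S => ∃ N, ∀ s ∈ S, s ∈ Icc 0 t1 → PB (μ s) N) ?_ ?_ ?_ ?_ |>.imp
      (fun N h s hs => h s hs (hab hs))
    · exact ⟨0, by simp⟩
    · rintro s t hst ⟨N, hN⟩
      exact ⟨N, fun u hu => hN u (hst hu)⟩
    · rintro s t ⟨N, hN⟩ ⟨N', hN'⟩
      refine ⟨max N N', fun u hu hu2 => ?_⟩
      rcases hu with hu | hu
      · exact (hN u hu hu2).mono (le_max_left _ _)
      · exact (hN' u hu hu2).mono (le_max_right _ _)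
    · intro x hx
      have := hnF x hx
      simp only [hFdef, mem_ofPred_eq, not_and] at this
      have := this (hab hx)
      push Not at this
      obtain ⟨N, ε, hε, h⟩ := this
      refine ⟨Metric.ball x ε, mem_nhdsWithin_of_mem_nhds (Metric.ball_mem_nhds x hε), N, ?_⟩
      intro s hs hs2
      exact h s hs2 (by rwa [Metric.mem_ball, Real.dist_eq] at hs)
  have hFclosed : IsClosed F := by
    rw [← isOpen_compl_iff, Metric.isOpen_iff]
    intro x hx
    by_cases hxI : x ∈ Icc 0 t1
    · have hx' : ¬ (x ∈ F) := hx
      simp only [hFdef, mem_ofPred_eq, not_and] at hx'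
      have := hx' hxI
      push Not at this
      obtain ⟨N, ε, hε, h⟩ := this
      refine ⟨ε / 2, by linarith, ?_⟩
      intro y hy hyF
      obtain ⟨s', hs', hd, hn⟩ := hyF.2 N (ε / 2) (by linarith)
      refine hn (h s' hs' ?_)
      rw [Metric.mem_ball, Real.dist_eq] at hy
      have := abs_sub_le s' y x
      linarith
    · obtain ⟨ε, hε, h⟩ := Metric.isOpen_iff.1 (isClosed_Icc (a := (0:ℝ)) (b := t1)).isOpen_compl x hxI
      exact ⟨ε, hε, fun y hy hyF => h hy hyF.1⟩
  have hFe : F = ∅ := by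
    by_contra hne
    obtain ⟨f0, hf0⟩ := nonempty_iff_ne_empty.2 hne
    haveI : Nonempty F := ⟨⟨f0, hf0⟩⟩
    haveI : CompleteSpace F := hFclosed.completeSpace_coe
    obtain ⟨n, hn⟩ := nonempty_interior_of_iUnion_of_closed
      (f := fun n : ℕ => {s : F | PB (μ s) n})
      (fun n => PB_closed hsol hprob n hFT) (by
        rw [eq_univ_iff_forall]
        intro s
        obtain ⟨N, hN⟩ := hcpt s (hFT s.2)
        obtain ⟨n, hn⟩ := exists_nat_ge N
        exact mem_iUnion.2 ⟨n, hN.mono hn⟩)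
    obtain ⟨⟨s0, hs0⟩, hint⟩ := hn
    rw [mem_interior_iff_mem_nhds, Metric.mem_nhds_iff] at hint
    obtain ⟨ε, hε, hball⟩ := hint
    have hFn : ∀ s ∈ F, |s - s0| < ε → PB (μ s) n := by
      intro s hs hd
      exact hball (show (⟨s, hs⟩ : F) ∈ Metric.ball _ _ by
        rw [Metric.mem_ball, Subtype.dist_eq, Real.dist_eq]; exact hd)
    set K := 6 + 8 * φM with hKdef
    have hK : 0 < K := by linarith
    set η := min ε (1 / (2 * K)) with hη
    have hη0 : 0 < η := lt_min hε (by positivity)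
    have hKη : ∀ x, x ≤ η → K * x ≤ 1 / 2 := by
      intro x hx
      have : x ≤ 1 / (2 * K) := hx.trans (min_le_right _ _)
      calc K * x ≤ K * (1 / (2 * K)) := by gcongr
        _ = 1 / 2 := by field_simp
    obtain ⟨s, hsI, hsd, hsn⟩ := hs0.2 (2 * n) η hη0
    apply hsn
    have hn0 : (0:ℝ) ≤ n := Nat.cast_nonneg n
    by_cases hsF : s ∈ F
    · exact (hFn s hsF (hsd.trans_le (min_le_left _ _))).mono (by linarith)
    obtain ⟨ρ, hρ⟩ := hcpt s ⟨hsI.1, hsI.2.trans_lt ht1⟩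
    rcases le_total s0 s with hle | hle
    · rw [abs_of_nonneg (by linarith)] at hsd
      have hcF : IsCompact (F ∩ Icc s0 s) := isCompact_Icc.inter_left hFclosed
      obtain ⟨a, ⟨haF, haI⟩, hamax⟩ := hcF.exists_isGreatest ⟨s0, hs0, le_rfl, hle⟩
      have has : a < s := lt_of_le_of_ne haI.2 (fun h => hsF (h ▸ haF))
      have hgap : ∀ u, a < u → u ≤ s → u ∉ F := fun u h1 h2 h3 =>
        absurd (hamax ⟨h3, by linarith [haI.1], h2⟩) (not_le.2 h1)
      have hbd : ∀ u, a < u → u ≤ s → PB (μ u) (2 * ρ) := by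
        intro u h1 h2
        obtain ⟨N, hN⟩ := hcomp u s (fun y hy => ⟨haF.1.1.trans (h1.le.trans hy.1), hy.2.trans hsI.2⟩)
          (fun y hy => hgap y (h1.trans_le hy.1) hy.2)
        exact dbl hφc hφ hsol hprob ρ u s N s (haF.1.1.trans h1.le) (hsI.2.trans_lt ht1)
          (hKη _ (by linarith [haI.1])) hN ⟨h2, le_rfl⟩ hρ u ⟨le_rfl, h2⟩
      have hPa : PB (μ a) n := hFn a haF (by
        rw [abs_of_nonneg (by linarith [haI.1])]
        linarith [min_le_left ε (1 / (2 * K))])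
      refine dbl hφc hφ hsol hprob n a s (max (2 * ρ) n) a haF.1.1 (hsI.2.trans_lt ht1)
          (hKη _ (by linarith [haI.1])) ?_ ⟨le_rfl, has.le⟩ hPa s ⟨has.le, le_rfl⟩
      intro u hu
      rcases hu.1.eq_or_lt with h | h
      · rw [← h]; exact hPa.mono (le_max_right _ _)
      · exact (hbd u h hu.2).mono (le_max_left _ _)
    · rw [abs_of_nonpos (by linarith)] at hsd
      have hcF : IsCompact (F ∩ Icc s s0) := isCompact_Icc.inter_left hFclosed
      obtain ⟨a, ⟨haF, haI⟩, hamin⟩ := hcF.exists_isLeast ⟨s0, hs0, hle, le_rfl⟩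
      have has : s < a := lt_of_le_of_ne haI.1 (fun h => hsF (h ▸ haF))
      have haT : a < T := haF.1.2.trans_lt ht1
      have hgap : ∀ u, s ≤ u → u < a → u ∉ F := fun u h1 h2 h3 =>
        absurd (hamin ⟨h3, h1, by linarith [haI.2]⟩) (not_le.2 h2)
      have hbd : ∀ u, s ≤ u → u < a → PB (μ u) (2 * ρ) := by
        intro u h1 h2
        obtain ⟨N, hN⟩ := hcomp s u (fun y hy => ⟨hsI.1.trans hy.1, hy.2.trans (h2.le.trans haF.1.2)⟩)
          (fun y hy => hgap y hy.1 (hy.2.trans_lt h2))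
        exact dbl hφc hφ hsol hprob ρ s u N s hsI.1 (h2.trans haT)
          (hKη _ (by linarith [haI.2])) hN ⟨le_rfl, h1⟩ hρ u ⟨h1, le_rfl⟩
      have hPa : PB (μ a) n := hFn a haF (by
        rw [abs_of_nonpos (by linarith [haI.2])]
        linarith [min_le_left ε (1 / (2 * K))])
      refine dbl hφc hφ hsol hprob n s a (max (2 * ρ) n) a hsI.1 haT
          (hKη _ (by linarith [haI.2])) ?_ ⟨has.le, le_rfl⟩ hPa s ⟨le_rfl, has.le⟩
      intro u hu
      rcases hu.2.eq_or_lt with h | h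
      · rw [h]; exact hPa.mono (le_max_right _ _)
      · exact (hbd u hu.1 h).mono (le_max_left _ _)
  exact hcomp 0 t1 subset_rfl (fun s _ hs => by rw [hFe] at hs; exact hs)

lemma unif_bdd {d : ℕ} {T : ℝ} (hT : 0 < T) {φ : ℝ → ℝ} (hφc : Continuous φ) {φM : ℝ}
    (hφ : ∀ r, 0 ≤ φ r ∧ φ r ≤ φM)
    {μ : ℝ → Measure (Phase d)}
    (hsol : IsMVSol 1 1 1 φ (Set.Ico 0 T) μ)
    (hprob : ∀ t ∈ Set.Ico (0:ℝ) T, IsProbabilityMeasure (μ t))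
    (hcpt : ∀ t ∈ Set.Ico (0:ℝ) T, ∃ N, PB (μ t) N) :
    ∃ N, ∀ s ∈ Ico 0 T, PB (μ s) N := by
  have hM : 0 ≤ φM := (hφ 0).1.trans (hφ 0).2
  set K := 6 + 8 * φM with hKdef
  have hK : 0 < K := by linarith
  obtain ⟨ρ, hρ⟩ := hcpt 0 ⟨le_rfl, hT⟩
  have hρ0 : 0 ≤ ρ := by
    have := hprob 0 ⟨le_rfl, hT⟩
    exact hρ.nonneg
  have main : ∀ n : ℕ, ∀ s ∈ Ico 0 T, s ≤ n * (1 / (2 * K)) → PB (μ s) (2 ^ n * ρ) := by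
    intro n
    induction n with
    | zero =>
      intro s hs hs2
      have : s = 0 := le_antisymm (by simpa using hs2) hs.1
      subst this
      simpa using hρ
    | succ k ih =>
      intro s hs hs2
      rcases le_total s (k * (1 / (2 * K))) with h | h
      · refine (ih s hs h).mono ?_
        gcongr
        · norm_num
        · omega
      · have hk0 : (0:ℝ) ≤ k * (1 / (2 * K)) := by positivity
        obtain ⟨N, hN⟩ := loc_bdd hφc hφ hsol hprob hcpt s hs.2
        have := dbl hφc hφ hsol hprob (2 ^ k * ρ) (k * (1 / (2 * K))) s N (k * (1 / (2 * K)))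
          hk0 hs.2 (by
            push_cast at hs2
            calc K * (s - k * (1 / (2 * K))) ≤ K * (1 / (2 * K)) := by gcongr; linarith
              _ = 1 / 2 := by field_simp)
          (fun u hu => hN u ⟨hk0.trans hu.1, hu.2⟩) ⟨le_rfl, h⟩
          (ih _ ⟨hk0, h.trans_lt hs.2⟩ le_rfl) s ⟨h, le_rfl⟩
        convert this using 1
        ring
  obtain ⟨n, hn⟩ := exists_nat_ge (T * (2 * K))
  refine ⟨2 ^ n * ρ, fun s hs => main n s hs (hs.2.le.trans ?_)⟩
  rw [mul_one_div, le_div_iff₀ (by positivity)]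
  exact hn

end Herd

/-- uniform boundedness of the supports of a compactly supported
measure-valued probability solution on compact time intervals, and the boundedness of
the bi-characteristics starting in the support of the initial datum. -/
theorem kinetic_herding_support_bound
    {d : ℕ} (hd : 1 ≤ d) (T : ℝ) (hT : 0 < T)
    (φ : ℝ → ℝ) (Kφ : NNReal) (hLip : LipschitzWith Kφ φ)
    (φM : ℝ) (hφM : 0 < φM) (hφ : ∀ r, 0 ≤ φ r ∧ φ r ≤ φM)
    (μ : ℝ → Measure (Phase d))
    (hsol : IsMVSol 1 1 1 φ (Set.Ico 0 T) μ)
    (hprob : ∀ t ∈ Set.Ico (0:ℝ) T, IsProbabilityMeasure (μ t))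
    (hcpt : ∀ t ∈ Set.Ico (0:ℝ) T, MeasureCompactSupport (μ t))
    (m₂ : ℝ) (hmom : ∀ t ∈ Set.Ico (0:ℝ) T, (∫ z, ‖z.2‖ ^ 2 ∂(μ t)) ≤ m₂) :
    (∀ t, 0 ≤ t → t < T → ∃ C : ℝ, ∀ s, 0 ≤ s → s ≤ t →
      ∀ z ∈ msupport (μ s), ‖z.1‖ < C ∧ ‖z.2‖ < C) ∧
    (∃ CT : ℝ, ∀ x v : Euc d, (x, v) ∈ msupport (μ 0) →
      ∀ X V : ℝ → Euc d, X 0 = x → V 0 = v →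
        (∀ s ∈ Set.Ico (0:ℝ) T,
          HasDerivWithinAt X (V s) (Set.Ico 0 T) s ∧
          HasDerivWithinAt V (herdQ 1 1 1 φ (μ s) (X s) (V s)) (Set.Ico 0 T) s) →
        ∀ s ∈ Set.Ico (0:ℝ) T, ‖X s‖ + ‖V s‖ ≤ CT) := by
  have hφc : Continuous φ := hLip.continuous
  have hM : 0 ≤ φM := hφM.le
  have hcpt' : ∀ t ∈ Set.Ico (0:ℝ) T, ∃ N, PB (μ t) N := by
    intro t ht
    obtain ⟨S, hS, hS0⟩ := hcpt t ht
    obtain ⟨N, hN⟩ := hS.exists_bound_of_continuousOn (en_cont (d := d)).continuousOn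
    refine ⟨N, ?_⟩
    have hae : ∀ᵐ z ∂(μ t), z ∈ S := mem_ae_iff.2 hS0
    unfold PB
    filter_upwards [hae] with z hz using (le_abs_self _).trans (hN z hz)
  obtain ⟨B, hB⟩ := unif_bdd hT hφc hφ hsol hprob hcpt'
  have hsupp : ∀ s ∈ Set.Ico (0:ℝ) T, ∀ z ∈ msupport (μ s), ‖z.1‖ ≤ √B ∧ ‖z.2‖ ≤ √B := by
    intro s hs z hz
    have hle : ‖z.1‖ ^ 2 + ‖z.2‖ ^ 2 ≤ B := by
      by_contra hcon
      push Not at hcon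
      have h1 := hz {y | B < en y} (isOpen_lt continuous_const en_cont) hcon
      have h2 : μ s {y | ¬ (en y ≤ B)} = 0 := ae_iff.1 (hB s hs)
      simp only [not_le] at h2
      exact h1.ne' h2
    exact ⟨Real.le_sqrt_of_sq_le (by nlinarith [sq_nonneg ‖z.2‖]),
      Real.le_sqrt_of_sq_le (by nlinarith [sq_nonneg ‖z.1‖])⟩
  constructor
  · intro t ht0 htT
    refine ⟨√B + 1, fun s hs0 hst z hz => ?_⟩
    have := hsupp s ⟨hs0, by linarith⟩ z hz
    exact ⟨by linarith [this.1], by linarith [this.2]⟩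
  · set L : ℝ := 1 + 2 * φM with hL
    have hL0 : L ≠ 0 := by positivity
    refine ⟨2 * (√B * Real.exp (L * T) + (L * √B) / L * (Real.exp (L * T) - 1)), ?_⟩
    intro x v hxv X V hX hV hode s hs
    have hmem := hsupp 0 ⟨le_rfl, hT⟩ _ hxv
    have hgr := norm_le_gronwallBound_of_norm_deriv_right_le (f := fun u => (X u, V u))
      (f' := fun u => (V u, herdQ 1 1 1 φ (μ u) (X u) (V u))) (δ := √B) (K := L) (ε := L * √B)
      (a := 0) (b := s) ?_ ?_ ?_ ?_ s ⟨hs.1, le_rfl⟩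
    · rw [gronwallBound_of_K_ne_0 hL0] at hgr
      simp only [sub_zero] at hgr
      have hexp : Real.exp (L * s) ≤ Real.exp (L * T) := by
        apply Real.exp_le_exp.2
        have : s ≤ T := hs.2.le
        have : 0 ≤ L := by positivity
        gcongr
      have hXn : ‖X s‖ ≤ ‖(X s, V s)‖ := norm_fst_le (X s, V s)
      have hVn : ‖V s‖ ≤ ‖(X s, V s)‖ := norm_snd_le (X s, V s)
      have e : L * √B / L = √B := by field_simp
      rw [e] at hgr ⊢
      have := mul_le_mul_of_nonneg_left hexp (Real.sqrt_nonneg B)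
      linarith
    · intro u hu
      have h := hode u ⟨hu.1, hu.2.trans_lt hs.2⟩
      exact (h.1.continuousWithinAt.prodMk h.2.continuousWithinAt).mono
        (fun y hy => ⟨hy.1, hy.2.trans_lt hs.2⟩)
    · intro u hu
      have huT : u < T := hu.2.trans hs.2
      have h := hode u ⟨hu.1, huT⟩
      refine (h.1.prodMk h.2).mono_of_mem_nhdsWithin ?_
      exact mem_of_superset (Ico_mem_nhdsGE huT) (Ico_subset_Ico_left hu.1)
    · simp only [hX, hV, Prod.norm_def]
      exact max_le hmem.1 hmem.2
    · intro u hu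
      have huT : u ∈ Set.Ico (0:ℝ) T := ⟨hu.1, hu.2.trans hs.2⟩
      have := hprob u huT
      have hQ := herdQ_bound hφ (μ u) (hB u huT) (X u) (V u)
      have hXn : ‖X u‖ ≤ ‖(X u, V u)‖ := norm_fst_le (X u, V u)
      have hVn : ‖V u‖ ≤ ‖(X u, V u)‖ := norm_snd_le (X u, V u)
      have hs0 := Real.sqrt_nonneg B
      have h0 := norm_nonneg (X u, V u)
      have p1 := mul_le_mul_of_nonneg_left hXn hM
      have p2 := mul_le_mul_of_nonneg_left hVn hM
      have p3 := mul_nonneg hM hs0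
      have p4 := mul_nonneg hM h0
      rw [Prod.norm_def (V u, _)]
      refine max_le ?_ ?_
      · simp only [hL]; linarith
      · refine hQ.trans ?_
        simp only [hL]; linarith
end
end

section
/- Let (μ_t) be a compactly supported measure-valued solution of the kinetic herding equation on [0,T). Then for every compactly supported C¹ function h on ℝ^d × ℝ^d and all 0 ≤ s, t < T, ∫ h(x,v) dμ_t(x,v) = ∫ h(X_μ(t;s,x,v), V_μ(t;s,x,v)) dμ_s(x,v); that is, μ_t is the pushforward of μ_s under the bi-characteristic flow from time s to time t. -/
open MeasureTheory Filter Set RealInnerProductSpace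

noncomputable section

structure Hyp {d : ℕ} (T : ℝ) (φ : ℝ → ℝ) (Kφ : NNReal) (φM : ℝ)
    (μ : ℝ → Measure (Phase d)) : Prop where
  lip : LipschitzWith Kφ φ
  pos : 0 < φM
  bd : ∀ r, 0 ≤ φ r ∧ φ r ≤ φM
  sol : IsMVSol 1 1 1 φ (Set.Ico 0 T) μ
  cpt : ∀ t ∈ Set.Ico (0:ℝ) T, MeasureCompactSupport (μ t)

def qd {d : ℕ} (z : Phase d) : ℝ := ‖z.1‖ ^ 2 + ‖z.2‖ ^ 2

def Nw {d : ℕ} (μ : Measure (Phase d)) : ℝ := ∫ z, (1 + qd z) ∂μ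

def bf {d : ℕ} (φ : ℝ → ℝ) (μ : Measure (Phase d)) (z : Phase d) : Phase d :=
  (z.2, herdQ 1 1 1 φ μ z.1 z.2)

lemma qd_nonneg {d : ℕ} (z : Phase d) : 0 ≤ qd z := by unfold qd; positivity

lemma qd_contDiff {d : ℕ} : ContDiff ℝ 1 (qd : Phase d → ℝ) := by
  unfold qd
  exact (contDiff_fst.norm_sq ℝ).add (contDiff_snd.norm_sq ℝ)

lemma qd_cont {d : ℕ} : Continuous (qd : Phase d → ℝ) := qd_contDiff.continuous

lemma w_cont {d : ℕ} : Continuous (fun z : Phase d => 1 + qd z) :=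
  continuous_const.add qd_cont

lemma norm_sq_le_qd {d : ℕ} (z : Phase d) : ‖z‖ ^ 2 ≤ qd z := by
  unfold qd
  rcases le_total ‖z.1‖ ‖z.2‖ with h | h
  · rw [Prod.norm_def, max_eq_right h]; nlinarith [sq_nonneg ‖z.1‖]
  · rw [Prod.norm_def, max_eq_left h]; nlinarith [sq_nonneg ‖z.2‖]

lemma qd_le_norm_sq {d : ℕ} (z : Phase d) : qd z ≤ 2 * ‖z‖ ^ 2 := by
  unfold qd
  have h1 := norm_fst_le z
  have h2 := norm_snd_le z
  nlinarith [norm_nonneg z.1, norm_nonneg z.2, norm_nonneg z]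

/-! static estimates -/

lemma integrable_of_cpt {d : ℕ} {E : Type*} [NormedAddCommGroup E] {μ : Measure (Phase d)}
    [IsFiniteMeasure μ] (h : MeasureCompactSupport μ) {k : Phase d → E} (hk : Continuous k) :
    Integrable k μ := by
  obtain ⟨K, hK, hK0⟩ := h
  have h1 : IntegrableOn k K μ := hk.continuousOn.integrableOn_compact hK
  have : μ.restrict K = μ := Measure.restrict_eq_self_of_ae_mem (by
    rw [ae_iff]; exact hK0)
  rwa [IntegrableOn, this] at h1

lemma mass_le_Nw {d : ℕ} {μ : Measure (Phase d)}
    [IsFiniteMeasure μ] (h : MeasureCompactSupport μ) : μ.real univ ≤ Nw μ := by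
  have : μ.real univ = ∫ z, (1:ℝ) ∂μ := by simp
  rw [this]
  apply integral_mono (integrable_const _) (integrable_of_cpt h w_cont)
  intro z
  have := qd_nonneg z
  simp only; linarith

lemma Nw_nonneg {d : ℕ} {μ : Measure (Phase d)} : 0 ≤ Nw μ := by
  apply integral_nonneg
  intro z
  have := qd_nonneg z
  show 0 ≤ 1 + qd z
  linarith

def herdI {d : ℕ} (φ : ℝ → ℝ) (x v : Euc d) (z : Phase d) : Euc d :=
  ((1:ℝ) • (z.1 - x) + (1 * φ ‖x - z.1‖) • (z.1 - x) + (1 * φ ‖x - z.1‖) • (z.2 - v))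

lemma herdI_cont {d : ℕ} {φ : ℝ → ℝ} (hφ : Continuous φ) (x v : Euc d) :
    Continuous (herdI φ x v) := by
  unfold herdI
  fun_prop

lemma herdI_norm {d : ℕ} {φ : ℝ → ℝ} {φM : ℝ} (hφ : ∀ r, 0 ≤ φ r ∧ φ r ≤ φM) (x v : Euc d)
    (z : Phase d) : ‖herdI φ x v z‖ ≤ (1 + φM) * (‖z.1‖ + ‖x‖ + ‖z.2‖ + ‖v‖) := by
  unfold herdI
  obtain ⟨h0, h1⟩ := hφ ‖x - z.1‖
  have ha : ‖z.1 - x‖ ≤ ‖z.1‖ + ‖x‖ := norm_sub_le _ _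
  have hb : ‖z.2 - v‖ ≤ ‖z.2‖ + ‖v‖ := norm_sub_le _ _
  refine (norm_add_le _ _).trans ?_
  refine (add_le_add_left (norm_add_le _ _) _).trans ?_
  rw [norm_smul, norm_smul, norm_smul]
  simp only [one_mul, Real.norm_eq_abs, abs_of_nonneg h0, abs_one]
  have e1 : φ ‖x - z.1‖ * ‖z.1 - x‖ ≤ φM * (‖z.1‖ + ‖x‖) := by gcongr; linarith
  have e2 : φ ‖x - z.1‖ * ‖z.2 - v‖ ≤ φM * (‖z.2‖ + ‖v‖) := by gcongr; linarith
  nlinarith [norm_nonneg z.2, norm_nonneg v]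

lemma herdQ_eq {d : ℕ} (φ : ℝ → ℝ) (μ : Measure (Phase d)) (x v : Euc d) :
    herdQ 1 1 1 φ μ x v = ∫ z, herdI φ x v z ∂μ := rfl

lemma herdQ_bound_s10 {d : ℕ} {φ : ℝ → ℝ} {φM : ℝ} (hM : 0 < φM) (hφ : ∀ r, 0 ≤ φ r ∧ φ r ≤ φM)
    {μ : Measure (Phase d)} [IsFiniteMeasure μ] (h : MeasureCompactSupport μ) (z : Phase d) :
    ‖z.2‖ * ‖herdQ 1 1 1 φ μ z.1 z.2‖ ≤
      (1 + φM) * (3 * μ.real univ * (1 + qd z) + Nw μ) := by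
  rw [herdQ_eq, ← norm_norm z.2, ← norm_smul, ← integral_smul]
  have hint : Integrable (fun y : Phase d => (1 + φM) * (3 * (1 + qd z) + (1 + qd y))) μ :=
    integrable_of_cpt h (by have := @qd_cont d; fun_prop)
  refine (norm_integral_le_of_norm_le hint (Eventually.of_forall ?_)).trans (le_of_eq ?_)
  · intro y
    rw [norm_smul, norm_norm]
    have := herdI_norm hφ z.1 z.2 y
    have h2 : ‖z.2‖ * ‖herdI φ z.1 z.2 y‖ ≤ ‖z.2‖ * ((1 + φM) * (‖y.1‖ + ‖z.1‖ + ‖y.2‖ + ‖z.2‖)) := by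
      gcongr
    refine h2.trans ?_
    have h3 : ‖z.2‖ * (‖y.1‖ + ‖z.1‖ + ‖y.2‖ + ‖z.2‖) ≤ 3 * (1 + qd z) + (1 + qd y) := by
      unfold qd
      nlinarith [sq_nonneg (‖z.2‖ - ‖y.1‖), sq_nonneg (‖z.2‖ - ‖z.1‖), sq_nonneg (‖z.2‖ - ‖y.2‖),
        sq_nonneg ‖z.1‖, sq_nonneg ‖y.1‖, sq_nonneg ‖y.2‖, sq_nonneg ‖z.2‖]
    calc _ = (1 + φM) * (‖z.2‖ * (‖y.1‖ + ‖z.1‖ + ‖y.2‖ + ‖z.2‖)) := by ring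
      _ ≤ _ := by gcongr
  · rw [integral_const_mul, integral_add (integrable_const _)
      (integrable_of_cpt h w_cont), integral_const]
    unfold Nw
    simp only [smul_eq_mul]
    ring

/-- derivative of `qd` at `z` in direction `a` -/
def dq {d : ℕ} (z a : Phase d) : ℝ := 2 * inner ℝ z.1 a.1 + 2 * inner ℝ z.2 a.2

lemma qd_hasDerivWithinAt {d : ℕ} {c : ℝ → Phase d} {c' : Phase d} {s : Set ℝ} {t : ℝ}
    (hc : HasDerivWithinAt c c' s t) :
    HasDerivWithinAt (fun τ => qd (c τ)) (dq (c t) c') s t := by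
  unfold qd dq
  have h1 : HasDerivWithinAt (fun τ => (c τ).1) c'.1 s t :=
    (ContinuousLinearMap.fst ℝ (Euc d) (Euc d)).hasFDerivAt.comp_hasDerivWithinAt t hc
  have h2 : HasDerivWithinAt (fun τ => (c τ).2) c'.2 s t :=
    (ContinuousLinearMap.snd ℝ (Euc d) (Euc d)).hasFDerivAt.comp_hasDerivWithinAt t hc
  exact h1.norm_sq.add h2.norm_sq

lemma qd_fderiv {d : ℕ} (z a : Phase d) : fderiv ℝ qd z a = dq z a := by
  have h1 : HasFDerivAt qd (fderiv ℝ qd z) z :=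
    (qd_contDiff.differentiable one_ne_zero z).hasFDerivAt
  have h2 : HasDerivAt (fun t : ℝ => z + t • a) a 0 := by
    simpa using ((hasDerivAt_id (0:ℝ)).smul_const a).const_add z
  have h1' : HasFDerivAt qd (fderiv ℝ qd z) (z + (0:ℝ) • a) := by simpa using h1
  have h3 := h1'.comp_hasDerivAt (0:ℝ) h2
  have h4 := (qd_hasDerivWithinAt (s := univ) (h2.hasDerivWithinAt)).hasDerivAt (by simp)
  have := h3.unique h4
  simpa using this

lemma dq_abs {d : ℕ} (z a : Phase d) : |dq z a| ≤ 2 * (‖z.1‖ * ‖a.1‖) + 2 * (‖z.2‖ * ‖a.2‖) := by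
  unfold dq
  have h1 := abs_real_inner_le_norm z.1 a.1
  have h2 := abs_real_inner_le_norm z.2 a.2
  rw [abs_le] at *
  constructor <;> linarith [h1.1, h1.2, h2.1, h2.2]

lemma dq_bf {d : ℕ} {φ : ℝ → ℝ} {φM : ℝ} (hM : 0 < φM) (hφ : ∀ r, 0 ≤ φ r ∧ φ r ≤ φM)
    {μ : Measure (Phase d)} [IsFiniteMeasure μ] (h : MeasureCompactSupport μ) (z : Phase d) :
    |dq z (bf φ μ z)| ≤ (1 + qd z) +
      2 * ((1 + φM) * (3 * μ.real univ * (1 + qd z) + Nw μ)) := by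
  refine (dq_abs _ _).trans ?_
  have := herdQ_bound_s10 hM hφ h z
  have h2 : 2 * (‖z.1‖ * ‖z.2‖) ≤ 1 + qd z := by
    unfold qd; nlinarith [sq_nonneg (‖z.1‖ - ‖z.2‖)]
  simp only [bf]
  linarith

lemma herdQ_lip {d : ℕ} {φ : ℝ → ℝ} {φM : ℝ} {K : NNReal} (hL : LipschitzWith K φ)
    (hM : 0 < φM) (hφ : ∀ r, 0 ≤ φ r ∧ φ r ≤ φM)
    {μ : Measure (Phase d)} [IsFiniteMeasure μ] (h : MeasureCompactSupport μ)
    {B ρ : ℝ} (hB : Nw μ ≤ B) (z y : Phase d) (hz : 1 + qd z ≤ ρ) :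
    ‖herdQ 1 1 1 φ μ z.1 z.2 - herdQ 1 1 1 φ μ y.1 y.2‖ ≤
      ((1 + φM) * B + K * (B + ρ * B)) * (‖z.1 - y.1‖ + ‖z.2 - y.2‖) := by
  rw [herdQ_eq, herdQ_eq, ← integral_sub (integrable_of_cpt h (herdI_cont hL.continuous _ _))
    (integrable_of_cpt h (herdI_cont hL.continuous _ _))]
  have hint : Integrable (fun w : Phase d =>
      ((1 + φM) + K * ρ) * (‖z.1 - y.1‖ + ‖z.2 - y.2‖)
        + (K * (‖z.1 - y.1‖ + ‖z.2 - y.2‖)) * (1 + qd w)) μ :=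
    integrable_of_cpt h (by have := @qd_cont d; fun_prop)
  refine (norm_integral_le_of_norm_le hint (Eventually.of_forall ?_)).trans ?_
  · intro w
    have hK0 : (0:ℝ) ≤ K := K.2
    set f1 := φ ‖z.1 - w.1‖ with hf1
    set f2 := φ ‖y.1 - w.1‖ with hf2
    have e : herdI φ z.1 z.2 w - herdI φ y.1 y.2 w =
        (1 + f2) • (y.1 - z.1) + (f1 - f2) • ((w.1 - z.1) + (w.2 - z.2)) + f2 • (y.2 - z.2) := by
      simp only [herdI, ← hf1, ← hf2, one_mul]
      module
    have hf : |f1 - f2| ≤ K * ‖z.1 - y.1‖ := by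
      have := hL.dist_le_mul ‖z.1 - w.1‖ ‖y.1 - w.1‖
      rw [Real.dist_eq, Real.dist_eq] at this
      refine this.trans ?_
      gcongr
      refine (abs_norm_sub_norm_le _ _).trans (le_of_eq ?_)
      congr 1; abel
    obtain ⟨g0, g1⟩ := hφ ‖y.1 - w.1‖
    rw [e]
    refine (norm_add_le _ _).trans ?_
    refine (add_le_add_left (norm_add_le _ _) _).trans ?_
    rw [norm_smul, norm_smul, norm_smul]
    simp only [Real.norm_eq_abs]
    rw [abs_of_nonneg (by linarith : 0 ≤ 1 + f2), abs_of_nonneg (by linarith : 0 ≤ f2),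
      norm_sub_rev y.1 z.1, norm_sub_rev y.2 z.2]
    have n1 : ‖(w.1 - z.1) + (w.2 - z.2)‖ ≤ (1 + qd w) + ρ := by
      refine (norm_add_le _ _).trans ?_
      have a1 := norm_sub_le w.1 z.1
      have a2 := norm_sub_le w.2 z.2
      have : ‖w.1‖ + ‖w.2‖ ≤ 1 + qd w := by
        unfold qd; nlinarith [sq_nonneg (‖w.1‖ - 1/2), sq_nonneg (‖w.2‖ - 1/2)]
      have : ‖z.1‖ + ‖z.2‖ ≤ 1 + qd z := by
        unfold qd; nlinarith [sq_nonneg (‖z.1‖ - 1/2), sq_nonneg (‖z.2‖ - 1/2)]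
      linarith
    have t1 : (1 + f2) * ‖z.1 - y.1‖ ≤ (1 + φM) * ‖z.1 - y.1‖ := by gcongr
    have t2 : f2 * ‖z.2 - y.2‖ ≤ (1 + φM) * ‖z.2 - y.2‖ := by gcongr; linarith
    have t3 : |f1 - f2| * ‖(w.1 - z.1) + (w.2 - z.2)‖ ≤
        (K * (‖z.1 - y.1‖ + ‖z.2 - y.2‖)) * ((1 + qd w) + ρ) := by
      have := norm_nonneg (z.2 - y.2)
      refine mul_le_mul (hf.trans ?_) n1 (norm_nonneg _) (by positivity)
      gcongr; linarith
    nlinarith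
  · have hm := mass_le_Nw h
    have hm0 : 0 ≤ μ.real univ := measureReal_nonneg
    have hρ : 0 ≤ ρ := by linarith [qd_nonneg z]
    rw [integral_add (integrable_const _)
      (integrable_of_cpt h (by have := @qd_cont d; fun_prop)), integral_const,
      integral_const_mul]
    change μ.real univ • _ + _ * Nw μ ≤ _
    rw [smul_eq_mul]
    have hK0 : (0:ℝ) ≤ K := K.2
    have : 0 ≤ ‖z.1 - y.1‖ + ‖z.2 - y.2‖ := by positivity
    set D := ‖z.1 - y.1‖ + ‖z.2 - y.2‖
    calc _ ≤ B * (((1 + φM) + K * ρ) * D) + K * D * B := by gcongr; linarith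
      _ = _ := by ring

lemma dq_bf_sub {d : ℕ} {φ : ℝ → ℝ} {φM : ℝ} {K : NNReal} (hL : LipschitzWith K φ)
    (hM : 0 < φM) (hφ : ∀ r, 0 ≤ φ r ∧ φ r ≤ φM)
    {μ : Measure (Phase d)} [IsFiniteMeasure μ] (h : MeasureCompactSupport μ)
    {B ρ : ℝ} (hB : Nw μ ≤ B) (z y : Phase d) (hz : 1 + qd z ≤ ρ) :
    |dq (z - y) (bf φ μ z - bf φ μ y)| ≤
      (1 + 3 * ((1 + φM) * B + K * (B + ρ * B))) * qd (z - y) := by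
  refine (dq_abs _ _).trans ?_
  have := herdQ_lip hL hM hφ h hB z y hz
  have hB0 : 0 ≤ B := Nw_nonneg.trans hB
  have hρ : 0 ≤ ρ := by linarith [qd_nonneg z]
  have hL0 : 0 ≤ (1 + φM) * B + K * (B + ρ * B) := by positivity
  simp only [bf, Prod.fst_sub, Prod.snd_sub, qd]
  set L0 := (1 + φM) * B + K * (B + ρ * B)
  set a := ‖z.1 - y.1‖
  set b := ‖z.2 - y.2‖
  have hb : 0 ≤ b := norm_nonneg _
  have : b * ‖herdQ 1 1 1 φ μ z.1 z.2 - herdQ 1 1 1 φ μ y.1 y.2‖ ≤ b * (L0 * (a + b)) := by gcongr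
  nlinarith [sq_nonneg (a - b), mul_nonneg hL0 (sq_nonneg (a - b)), mul_nonneg hL0 (sq_nonneg a)]


def chiB : ContDiffBump (0:ℝ) := ⟨1, 2, by norm_num, by norm_num⟩

def cut (u : ℝ) : ℝ := chiB u

lemma cut_contDiff : ContDiff ℝ 1 cut := chiB.contDiff
lemma cut_cont : Continuous cut := cut_contDiff.continuous
lemma cut_cs : HasCompactSupport cut := chiB.hasCompactSupport
lemma cut_nonneg (u : ℝ) : 0 ≤ cut u := chiB.nonneg
lemma cut_le_one (u : ℝ) : cut u ≤ 1 := chiB.le_one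
lemma cut_one {u : ℝ} (h : |u| ≤ 1) : cut u = 1 :=
  chiB.one_of_mem_closedBall (by simpa [chiB] using h)
lemma cut_zero {u : ℝ} (h : 2 ≤ |u|) : cut u = 0 :=
  chiB.zero_of_le_dist (by simpa [chiB] using h)

lemma radial_cs {d : ℕ} {Θ : ℝ → ℝ} {R : ℝ} (h : ∀ u, R ≤ u → Θ u = 0) :
    HasCompactSupport (fun z : Phase d => Θ (1 + qd z)) := by
  apply HasCompactSupport.intro (isCompact_closedBall (0 : Phase d) (|R| + 1))
  intro z hz
  apply h
  simp only [Metric.mem_closedBall, dist_zero_right, not_le] at hz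
  have := norm_sq_le_qd z
  have h1 : |R| + 1 ≤ ‖z‖ ^ 2 := by nlinarith [abs_nonneg R]
  linarith [le_abs_self R]

lemma Hyp.fin {d : ℕ} {T : ℝ} {φ : ℝ → ℝ} {Kφ : NNReal} {φM : ℝ} {μ : ℝ → Measure (Phase d)}
    (H : Hyp T φ Kφ φM μ) {t : ℝ} (ht : t ∈ Ico 0 T) : IsFiniteMeasure (μ t) := H.sol.1 t ht

lemma Hyp.cont_cs {d : ℕ} {T : ℝ} {φ : ℝ → ℝ} {Kφ : NNReal} {φM : ℝ} {μ : ℝ → Measure (Phase d)}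
    (H : Hyp T φ Kφ φM μ) {g : Phase d → ℝ} (hg : Continuous g) (hc : HasCompactSupport g) :
    ContinuousOn (fun t => ∫ z, g z ∂(μ t)) (Ico 0 T) :=
  H.sol.2.1 ⟨⟨g, hg⟩, hc.is_zero_at_infty⟩

lemma Hyp.tcont {d : ℕ} {T : ℝ} {φ : ℝ → ℝ} {Kφ : NNReal} {φM : ℝ} {μ : ℝ → Measure (Phase d)}
    (H : Hyp T φ Kφ φM μ) {p q B : ℝ} (hpq : Icc p q ⊆ Ico 0 T)
    (hB : ∀ σ ∈ Icc p q, Nw (μ σ) ≤ B) {k : Phase d → ℝ} (hk : Continuous k)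
    {C : ℝ} (hC : 0 ≤ C) (hkC : ∀ z, |k z| ≤ C * √(1 + qd z)) :
    ContinuousOn (fun t => ∫ z, k z ∂(μ t)) (Icc p q) := by
  let F : ℕ → ℝ → ℝ := fun n t => ∫ z, k z * cut ((1 + qd z) / (n + 1) ^ 2) ∂(μ t)
  have hkc : ∀ n : ℕ, Continuous fun z : Phase d => k z * cut ((1 + qd z) / (n + 1) ^ 2) := by
    intro n
    have := @w_cont d
    have := cut_cont
    fun_prop
  have hF : ∀ n, ContinuousOn (F n) (Icc p q) := by
    intro n
    refine (H.cont_cs (hkc n) ?_).mono hpq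
    apply HasCompactSupport.mul_left
    apply radial_cs (Θ := fun u => cut (u / (n + 1) ^ 2)) (R := 2 * (n + 1) ^ 2)
    intro u hu
    apply cut_zero
    rw [abs_of_nonneg (by have : 0 ≤ u := le_trans (by positivity) hu
                          positivity), le_div_iff₀ (by positivity)]
    exact hu
  refine TendstoUniformlyOn.continuousOn (F := F) (p := atTop) ?_ (Frequently.of_forall hF)
  rw [Metric.tendstoUniformlyOn_iff]
  intro ε hε
  have hlim : Tendsto (fun n : ℕ => (C * B) * (1 / ((n:ℝ) + 1))) atTop (nhds ((C * B) * 0)) :=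
    tendsto_one_div_add_atTop_nhds_zero_nat.const_mul _
  rw [mul_zero] at hlim
  filter_upwards [hlim.eventually_lt_const hε] with n hn σ hσ
  refine lt_of_le_of_lt ?_ hn
  have := H.fin (hpq hσ)
  have hc := H.cpt σ (hpq hσ)
  simp only [F]
  rw [Real.dist_eq, ← integral_sub (integrable_of_cpt hc hk) (integrable_of_cpt hc (hkc n))]
  have hint : Integrable (fun z : Phase d => (C * (1 / ((n:ℝ) + 1))) * (1 + qd z)) (μ σ) :=
    integrable_of_cpt hc (continuous_const.mul w_cont)
  rw [← Real.norm_eq_abs]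
  refine (norm_integral_le_of_norm_le hint (Eventually.of_forall ?_)).trans ?_
  · intro z
    have hw : 0 < 1 + qd z := by linarith [qd_nonneg z]
    have e : k z - k z * cut ((1 + qd z) / (n + 1) ^ 2)
        = k z * (1 - cut ((1 + qd z) / (n + 1) ^ 2)) := by ring
    rw [e, norm_mul, Real.norm_eq_abs, Real.norm_eq_abs,
      abs_of_nonneg (sub_nonneg.2 (cut_le_one _))]
    by_cases hz : (1 + qd z) / (n + 1) ^ 2 ≤ 1
    · rw [cut_one (by rw [abs_of_nonneg (by positivity)]; exact hz)]
      simp only [sub_self, mul_zero]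
      positivity
    · rw [not_le, one_lt_div (by positivity)] at hz
      have h1 : (n + 1 : ℝ) ≤ √(1 + qd z) := Real.le_sqrt_of_sq_le hz.le
      have h2 : √(1 + qd z) * √(1 + qd z) = 1 + qd z := Real.mul_self_sqrt hw.le
      calc |k z| * (1 - cut ((1 + qd z) / (n + 1) ^ 2)) ≤ (C * √(1 + qd z)) * 1 := by
            gcongr
            · linarith [cut_le_one ((1 + qd z) / (n + 1) ^ 2), cut_nonneg ((1 + qd z) / (n + 1) ^ 2)]
            · exact hkC z
            · linarith [cut_nonneg ((1 + qd z) / (n + 1) ^ 2)]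
        _ ≤ _ := by
          rw [mul_one, mul_assoc]
          gcongr
          rw [one_div, inv_mul_eq_div, le_div_iff₀ (by positivity)]
          nlinarith [Real.sqrt_nonneg (1 + qd z)]
  · rw [integral_const_mul]
    change _ * Nw (μ σ) ≤ _
    have := hB σ hσ
    calc _ ≤ (C * (1 / ((n:ℝ) + 1))) * B := by gcongr
      _ = _ := by ring

lemma Hyp.herdQ_tcont {d : ℕ} {T : ℝ} {φ : ℝ → ℝ} {Kφ : NNReal} {φM : ℝ}
    {μ : ℝ → Measure (Phase d)}
    (H : Hyp T φ Kφ φM μ) {p q B : ℝ} (hpq : Icc p q ⊆ Ico 0 T)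
    (hB : ∀ σ ∈ Icc p q, Nw (μ σ) ≤ B) (x v : Euc d) :
    ContinuousOn (fun t => herdQ 1 1 1 φ (μ t) x v) (Icc p q) := by
  have hc := herdI_cont H.lip.continuous x v
  have key : ∀ i, ContinuousOn (fun t => (herdQ 1 1 1 φ (μ t) x v) i) (Icc p q) := by
    intro i
    have hM := H.pos
    have := H.tcont hpq hB (k := fun z => (herdI φ x v z) i)
      (C := (1 + φM) * (2 + ‖x‖ + ‖v‖)) (by fun_prop) (by positivity) ?_
    · refine this.congr ?_
      intro t ht
      have := H.fin (hpq ht)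
      exact ((EuclideanSpace.proj i : Euc d →L[ℝ] ℝ).integral_comp_comm
        (integrable_of_cpt (H.cpt t (hpq ht)) hc)).symm
    · intro z
      have h1 : |herdI φ x v z i| ≤ ‖herdI φ x v z‖ := by
        simpa using PiLp.norm_apply_le (herdI φ x v z) i
      refine (h1.trans (herdI_norm H.bd x v z)).trans ?_
      rw [mul_assoc]
      gcongr
      have a1 : ‖z.1‖ ≤ √(1 + qd z) := by
        apply Real.le_sqrt_of_sq_le; unfold qd; nlinarith [sq_nonneg ‖z.2‖]
      have a2 : ‖z.2‖ ≤ √(1 + qd z) := by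
        apply Real.le_sqrt_of_sq_le; unfold qd; nlinarith [sq_nonneg ‖z.1‖]
      have a3 : 1 ≤ √(1 + qd z) := by
        apply Real.le_sqrt_of_sq_le; linarith [qd_nonneg z]
      nlinarith [norm_nonneg x, norm_nonneg v]
  have h2 : ContinuousOn (fun t => WithLp.ofLp (herdQ 1 1 1 φ (μ t) x v)) (Icc p q) :=
    continuousOn_pi.2 key
  exact (PiLp.continuous_toLp 2 _).comp_continuousOn h2

lemma Hyp.herdQ_cont {d : ℕ} {T : ℝ} {φ : ℝ → ℝ} {Kφ : NNReal} {φM : ℝ}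
    {μ : ℝ → Measure (Phase d)}
    (H : Hyp T φ Kφ φM μ) {p q B : ℝ} (hpq : Icc p q ⊆ Ico 0 T)
    (hB : ∀ σ ∈ Icc p q, Nw (μ σ) ≤ B) :
    ContinuousOn (fun y : ℝ × Phase d => herdQ 1 1 1 φ (μ y.1) y.2.1 y.2.2)
      (Icc p q ×ˢ univ) := by
  have key : ∀ ρ : ℝ, ContinuousOn (fun y : ℝ × Phase d => herdQ 1 1 1 φ (μ y.1) y.2.1 y.2.2)
      (Icc p q ×ˢ {z | 1 + qd z < ρ}) := by
    intro ρ
    refine continuousOn_prod_of_continuousOn_lipschitzOnWith' _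
      (Real.toNNReal (2 * ((1 + φM) * B + Kφ * (B + ρ * B)))) ?_ ?_
    · intro σ hσ
      apply LipschitzOnWith.of_dist_le_mul
      intro z hz y hy
      have := H.fin (hpq hσ)
      have h1 := herdQ_lip H.lip H.pos H.bd (H.cpt σ (hpq hσ)) (hB σ hσ) z y (le_of_lt hz)
      have hB0 : 0 ≤ B := Nw_nonneg.trans (hB σ hσ)
      have hρ : 0 ≤ ρ := by have : 1 + qd z < ρ := hz; linarith [qd_nonneg z]
      have hM := H.pos
      rw [dist_eq_norm, dist_eq_norm, Real.coe_toNNReal _ (by positivity)]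
      refine h1.trans ?_
      have a1 := norm_fst_le (z - y)
      have a2 := norm_snd_le (z - y)
      simp only [Prod.fst_sub, Prod.snd_sub] at a1 a2
      calc _ ≤ ((1 + φM) * B + Kφ * (B + ρ * B)) * (‖z - y‖ + ‖z - y‖) := by gcongr
        _ = _ := by ring
    · intro z _
      exact H.herdQ_tcont hpq hB z.1 z.2
  rintro ⟨σ, z⟩ ⟨hσ, -⟩
  have := key (1 + qd z + 1) (σ, z) ⟨hσ, by simp⟩
  refine this.mono_of_mem_nhdsWithin ?_
  rw [nhdsWithin_prod_eq]
  refine prod_mem_prod self_mem_nhdsWithin ?_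
  rw [nhdsWithin_univ]
  exact (isOpen_lt w_cont continuous_const).mem_nhds (by simp)

lemma Hyp.pair_cont {d : ℕ} {T : ℝ} {φ : ℝ → ℝ} {Kφ : NNReal} {φM : ℝ}
    {μ : ℝ → Measure (Phase d)}
    (H : Hyp T φ Kφ φM μ) {p q B : ℝ} (hpq : Icc p q ⊆ Ico 0 T)
    (hB : ∀ σ ∈ Icc p q, Nw (μ σ) ≤ B) {G : ℝ × Phase d → ℝ}
    (hG : ContinuousOn G (Icc p q ×ˢ univ)) {K : Set (Phase d)} (hK : IsCompact K)
    (hGK : ∀ σ ∈ Icc p q, ∀ z, z ∉ K → G (σ, z) = 0) :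
    ContinuousOn (fun σ => ∫ z, G (σ, z) ∂(μ σ)) (Icc p q) := by
  have hGs : ∀ σ ∈ Icc p q, Continuous fun z => G (σ, z) := by
    intro σ hσ
    rw [← continuousOn_univ]
    exact hG.comp (by fun_prop) (fun z _ => ⟨hσ, mem_univ _⟩)
  have hu : UniformContinuousOn G (Icc p q ×ˢ K) :=
    (isCompact_Icc.prod hK).uniformContinuousOn_of_continuous
      (hG.mono (prod_mono_right (subset_univ _)))
  intro σ0 hσ0
  have hB0 : 0 ≤ B := Nw_nonneg.trans (hB σ0 hσ0)
  rw [Metric.continuousWithinAt_iff]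
  intro ε hε
  rw [Metric.uniformContinuousOn_iff] at hu
  obtain ⟨δ, hδ, hu⟩ := hu (ε / (2 * (B + 1))) (by positivity)
  have hc : ContinuousOn (fun t => ∫ z, G (σ0, z) ∂(μ t)) (Icc p q) :=
    (H.cont_cs (hGs σ0 hσ0) (HasCompactSupport.intro hK (hGK σ0 hσ0))).mono hpq
  obtain ⟨δ', hδ', hc⟩ := Metric.continuousWithinAt_iff.1 (hc σ0 hσ0) (ε / 2) (by positivity)
  refine ⟨min δ δ', by positivity, ?_⟩
  intro σ hσ hd
  have := H.fin (hpq hσ)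
  have hcp := H.cpt σ (hpq hσ)
  have h2 := hc hσ (hd.trans_le (min_le_right _ _))
  refine (dist_triangle _ (∫ z, G (σ0, z) ∂(μ σ)) _).trans_lt ?_
  suffices dist (∫ z, G (σ, z) ∂(μ σ)) (∫ z, G (σ0, z) ∂(μ σ)) ≤ ε / 2 by linarith
  rw [dist_eq_norm, ← integral_sub (integrable_of_cpt hcp (hGs σ hσ))
    (integrable_of_cpt hcp (hGs σ0 hσ0))]
  refine (norm_integral_le_of_norm_le_const (C := ε / (2 * (B + 1))) (Eventually.of_forall ?_)).trans ?_
  · intro z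
    by_cases hz : z ∈ K
    · refine (hu (σ, z) ⟨hσ, hz⟩ (σ0, z) ⟨hσ0, hz⟩ ?_).le
      rw [Prod.dist_eq]
      simpa [hδ] using hd.trans_le (min_le_left _ _)
    · rw [hGK σ hσ z hz, hGK σ0 hσ0 z hz]; simp; positivity
  · have hm := (mass_le_Nw hcp).trans (hB σ hσ)
    calc ε / (2 * (B + 1)) * (μ σ).real univ ≤ ε / (2 * (B + 1)) * (B + 1) := by
          gcongr; linarith
      _ = ε / 2 := by field_simp


/-- transport derivative of a test function -/
def TD {d : ℕ} (φ : ℝ → ℝ) (μ : ℝ → Measure (Phase d)) (g : Phase d × ℝ → ℝ) (y : ℝ × Phase d) : ℝ :=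
  fderiv ℝ g (y.2, y.1) (bf φ (μ y.1) y.2, 1)

lemma TD_eq {d : ℕ} {φ : ℝ → ℝ} {μ : ℝ → Measure (Phase d)} {g : Phase d × ℝ → ℝ}
    (hg : ContDiff ℝ 1 g) (s : ℝ) (z : Phase d) :
    (deriv (fun u => g (z, u)) s
          + (fderiv ℝ (fun y => g ((y, z.2), s)) z.1) z.2
          + (fderiv ℝ (fun w => g ((z.1, w), s)) z.2)
              (herdQ 1 1 1 φ (μ s) z.1 z.2)) = TD φ μ g (s, z) := by
  have hd : HasFDerivAt g (fderiv ℝ g (z, s)) (z, s) :=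
    (hg.differentiable one_ne_zero _).hasFDerivAt
  have h1 : deriv (fun u => g (z, u)) s = fderiv ℝ g (z, s) (0, 1) := by
    have : HasDerivAt (fun u : ℝ => (z, u)) ((0 : Phase d), (1:ℝ)) s :=
      (hasDerivAt_const s z).prodMk (hasDerivAt_id s)
    exact (hd.comp_hasDerivAt s this).deriv
  have h2 : (fderiv ℝ (fun y => g ((y, z.2), s)) z.1) z.2 = fderiv ℝ g (z, s) ((z.2, 0), 0) := by
    have : HasFDerivAt (fun y : Euc d => ((y, z.2), s))
        (((ContinuousLinearMap.id ℝ (Euc d)).prod 0).prod 0) z.1 :=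
      ((hasFDerivAt_id z.1).prodMk (hasFDerivAt_const z.2 z.1)).prodMk (hasFDerivAt_const s z.1)
    have h := HasFDerivAt.comp (g := g) z.1 hd this
    rw [show (fun y => g ((y, z.2), s)) = g ∘ fun y : Euc d => ((y, z.2), s) from rfl, h.fderiv]
    simp
  have h3 : ∀ a, (fderiv ℝ (fun y => g ((z.1, y), s)) z.2) a = fderiv ℝ g (z, s) ((0, a), 0) := by
    intro a
    have : HasFDerivAt (fun y : Euc d => ((z.1, y), s))
        (((0 : Euc d →L[ℝ] Euc d).prod (ContinuousLinearMap.id ℝ (Euc d))).prod 0) z.2 :=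
      ((hasFDerivAt_const z.1 z.2).prodMk (hasFDerivAt_id z.2)).prodMk (hasFDerivAt_const s z.2)
    have h := HasFDerivAt.comp (g := g) z.2 hd this
    rw [show (fun y => g ((z.1, y), s)) = g ∘ fun y : Euc d => ((z.1, y), s) from rfl, h.fderiv]
    simp
  rw [h1, h2, h3, ← map_add, ← map_add]
  simp [TD, bf]

lemma Hyp.weak0 {d : ℕ} {T : ℝ} {φ : ℝ → ℝ} {Kφ : NNReal} {φM : ℝ}
    {μ : ℝ → Measure (Phase d)}
    (H : Hyp T φ Kφ φM μ) {g : Phase d × ℝ → ℝ} (hg : ContDiff ℝ 1 g) (hc : HasCompactSupport g)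
    {t : ℝ} (ht : t ∈ Ico 0 T) :
    (∫ z, g (z, t) ∂(μ t)) - (∫ z, g (z, 0) ∂(μ 0)) =
      ∫ s in (0:ℝ)..t, (∫ z, TD φ μ g (s, z) ∂(μ s)) := by
  rw [H.sol.2.2 g hg hc t ht]
  simp only [TD_eq hg]

lemma TD_cpt {d : ℕ} {φ : ℝ → ℝ} {μ : ℝ → Measure (Phase d)} {g : Phase d × ℝ → ℝ}
    (σ : ℝ) (z : Phase d) (hz : z ∉ Prod.fst '' (tsupport g)) : TD φ μ g (σ, z) = 0 := by
  have : (z, σ) ∉ tsupport g := fun h => hz ⟨_, h, rfl⟩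
  have h2 : (z, σ) ∉ tsupport (fderiv ℝ g) := fun h => this (tsupport_fderiv_subset ℝ h)
  simp [TD, image_eq_zero_of_notMem_tsupport h2]

lemma Hyp.TD_contOn {d : ℕ} {T : ℝ} {φ : ℝ → ℝ} {Kφ : NNReal} {φM : ℝ}
    {μ : ℝ → Measure (Phase d)}
    (H : Hyp T φ Kφ φM μ) {p q B : ℝ} (hpq : Icc p q ⊆ Ico 0 T)
    (hB : ∀ σ ∈ Icc p q, Nw (μ σ) ≤ B) {g : Phase d × ℝ → ℝ} (hg : ContDiff ℝ 1 g) :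
    ContinuousOn (TD φ μ g) (Icc p q ×ˢ univ) := by
  have h1 : Continuous fun y : ℝ × Phase d => fderiv ℝ g (y.2, y.1) :=
    (hg.continuous_fderiv one_ne_zero).comp (by fun_prop)
  have h2 : ContinuousOn (fun y : ℝ × Phase d => (bf φ (μ y.1) y.2, (1:ℝ))) (Icc p q ×ˢ univ) := by
    refine ContinuousOn.prodMk ?_ continuousOn_const
    unfold bf
    exact ContinuousOn.prodMk (by fun_prop) (H.herdQ_cont hpq hB)
  exact h1.continuousOn.clm_apply h2

lemma Hyp.ITD_cont {d : ℕ} {T : ℝ} {φ : ℝ → ℝ} {Kφ : NNReal} {φM : ℝ}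
    {μ : ℝ → Measure (Phase d)}
    (H : Hyp T φ Kφ φM μ) {p q B : ℝ} (hpq : Icc p q ⊆ Ico 0 T)
    (hB : ∀ σ ∈ Icc p q, Nw (μ σ) ≤ B) {g : Phase d × ℝ → ℝ} (hg : ContDiff ℝ 1 g)
    (hc : HasCompactSupport g) :
    ContinuousOn (fun s => ∫ z, TD φ μ g (s, z) ∂(μ s)) (Icc p q) :=
  H.pair_cont hpq hB (H.TD_contOn hpq hB hg) (hc.isCompact.image continuous_fst)
    (fun σ _ z hz => TD_cpt σ z hz)

lemma TD_congr {d : ℕ} {φ : ℝ → ℝ} {μ : ℝ → Measure (Phase d)} {g g' : Phase d × ℝ → ℝ}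
    {S : Set ℝ} (hS : IsOpen S) (h : ∀ z, ∀ τ ∈ S, g (z, τ) = g' (z, τ)) {σ : ℝ} (hσ : σ ∈ S)
    (z : Phase d) : TD φ μ g (σ, z) = TD φ μ g' (σ, z) := by
  unfold TD
  have : g =ᶠ[nhds (z, σ)] g' := by
    filter_upwards [(isOpen_univ.prod hS).mem_nhds (⟨mem_univ z, hσ⟩ : (z, σ) ∈ univ ×ˢ S)] with y hy
    exact h y.1 y.2 hy.2
  simp only [this.fderiv_eq]

lemma Hyp.weakB {d : ℕ} {T : ℝ} {φ : ℝ → ℝ} {Kφ : NNReal} {φM : ℝ}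
    {μ : ℝ → Measure (Phase d)}
    (H : Hyp T φ Kφ φM μ) {p q B : ℝ} (hle : p ≤ q) (hpq : Icc p q ⊆ Ico 0 T)
    (hB : ∀ σ ∈ Icc p q, Nw (μ σ) ≤ B) {g : Phase d × ℝ → ℝ} (hg : ContDiff ℝ 1 g)
    (hc : HasCompactSupport g) :
    (∫ z, g (z, q) ∂(μ q)) - (∫ z, g (z, p) ∂(μ p)) =
      ∫ s in p..q, (∫ z, TD φ μ g (s, z) ∂(μ s)) := by
  rcases hle.eq_or_lt with rfl | hlt
  · simp
  have hcont := H.ITD_cont hpq hB hg hc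
  have hp0 : 0 ≤ p := (hpq (left_mem_Icc.2 hle)).1
  have key : EqOn (fun r => (∫ z, g (z, q) ∂(μ q)) - (∫ z, g (z, r) ∂(μ r)))
      (fun r => ∫ s in r..q, (∫ z, TD φ μ g (s, z) ∂(μ s))) (Ioc p q) := by
    intro r hr
    obtain ⟨a, hpa, har⟩ := exists_between hr.1
    obtain ⟨b, hab, hbr⟩ := exists_between har
    let η : ℝ → ℝ := fun τ => Real.smoothTransition ((τ - a) / (b - a))
    have hη0 : ∀ τ, τ ≤ a → η τ = 0 := fun τ h =>
      Real.smoothTransition.zero_of_nonpos (div_nonpos_of_nonpos_of_nonneg (by linarith) (by linarith))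
    have hη1 : ∀ τ, b ≤ τ → η τ = 1 := fun τ h =>
      Real.smoothTransition.one_of_one_le ((one_le_div (by linarith)).2 (by linarith))
    have hηc : ContDiff ℝ 1 η := by
      apply Real.smoothTransition.contDiff.comp
      fun_prop
    let G : Phase d × ℝ → ℝ := fun y => g y * η y.2
    have hG : ContDiff ℝ 1 G := hg.mul (hηc.comp contDiff_snd)
    have hGc : HasCompactSupport G := hc.mul_right
    have hI0 : ∀ s ∈ Iio a, ∫ z, TD φ μ G (s, z) ∂(μ s) = 0 := by
      intro s hs
      have : ∀ z, TD φ μ G (s, z) = 0 := by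
        intro z
        rw [TD_congr (g' := fun _ => 0) isOpen_Iio (fun z τ hτ => ?_) hs]
        · simp [TD]
        · simp [G, hη0 τ (le_of_lt hτ)]
      simp [this]
    have hI1 : ∀ s ∈ Ioi b, ∫ z, TD φ μ G (s, z) ∂(μ s) = ∫ z, TD φ μ g (s, z) ∂(μ s) := by
      intro s hs
      have : ∀ z, TD φ μ G (s, z) = TD φ μ g (s, z) := by
        intro z
        exact TD_congr isOpen_Ioi (fun z τ hτ => by simp [G, hη1 τ (le_of_lt hτ)]) hs z
      simp [this]
    have hcG := H.ITD_cont hpq hB hG hGc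
    have hii0 : IntervalIntegrable (fun s => ∫ z, TD φ μ G (s, z) ∂(μ s)) volume 0 p := by
      have : IntervalIntegrable (fun _ : ℝ => (0:ℝ)) volume 0 p := intervalIntegrable_const
      refine this.congr ?_
      intro s hs
      rw [uIoc_of_le hp0] at hs
      exact (hI0 s (lt_of_le_of_lt hs.2 hpa)).symm
    have hii : ∀ τ ∈ Icc p q,
        IntervalIntegrable (fun s => ∫ z, TD φ μ G (s, z) ∂(μ s)) volume 0 τ := by
      intro τ hτ
      refine hii0.trans (ContinuousOn.intervalIntegrable ?_)
      rw [uIcc_of_le hτ.1]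
      exact hcG.mono (Icc_subset_Icc_right hτ.2)
    have hw : ∀ τ ∈ Icc r q, ∫ z, g (z, τ) ∂(μ τ) =
        ∫ s in (0:ℝ)..τ, (∫ z, TD φ μ G (s, z) ∂(μ s)) := by
      intro τ hτ
      rw [← H.weak0 hG hGc (hpq ⟨hr.1.le.trans hτ.1, hτ.2⟩)]
      simp only [G]
      rw [hη0 0 (by linarith), hη1 τ (by linarith [hτ.1])]
      simp
    simp only
    rw [hw q (right_mem_Icc.2 hr.2), hw r (left_mem_Icc.2 hr.2),
      intervalIntegral.integral_interval_sub_left (hii q ⟨hle, le_rfl⟩) (hii r ⟨hr.1.le, hr.2⟩)]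
    apply intervalIntegral.integral_congr
    intro s hs
    rw [uIcc_of_le hr.2] at hs
    exact hI1 s (lt_of_lt_of_le hbr hs.1)
  have hgc : ContinuousOn (fun r => ∫ z, g (z, r) ∂(μ r)) (Icc p q) := by
    refine H.pair_cont hpq hB (G := fun y => g (y.2, y.1)) (hg.continuous.comp (by fun_prop)).continuousOn
      (hc.isCompact.image continuous_fst) (fun σ _ z hz => ?_)
    exact image_eq_zero_of_notMem_tsupport (fun h => hz ⟨_, h, rfl⟩)
  have hrc : ContinuousOn (fun r => ∫ s in r..q, (∫ z, TD φ μ g (s, z) ∂(μ s))) (Icc p q) := by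
    have := intervalIntegral.continuousOn_primitive_interval_left (μ := volume) (a := p) (b := q)
      (f := fun s => ∫ z, TD φ μ g (s, z) ∂(μ s)) (by
        rw [uIcc_of_le hle]
        exact hcont.integrableOn_compact isCompact_Icc)
    rwa [uIcc_of_le hle] at this
  exact key.of_subset_closure (continuousOn_const.sub hgc) hrc Ioc_subset_Icc_self
    (by rw [closure_Ioc hlt.ne]) (left_mem_Icc.2 hle)

/-! radial test functions -/

lemma Hyp.radial {d : ℕ} {T : ℝ} {φ : ℝ → ℝ} {Kφ : NNReal} {φM : ℝ}
    {μ : ℝ → Measure (Phase d)}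
    (H : Hyp T φ Kφ φM μ) {p q B m : ℝ} (hle : p ≤ q) (hpq : Icc p q ⊆ Ico 0 T)
    (hB : ∀ σ ∈ Icc p q, Nw (μ σ) ≤ B) (hm : ∀ σ ∈ Icc p q, (μ σ).real univ ≤ m)
    {Θ : ℝ → ℝ} (hΘ : ContDiff ℝ 1 Θ) {R C : ℝ} (hR : ∀ u, R ≤ u → Θ u = 0)
    (hC : ∀ u, |deriv Θ u| ≤ C) :
    |(∫ z, Θ (1 + qd z) ∂(μ q)) - (∫ z, Θ (1 + qd z) ∂(μ p))| ≤
      C * ((1 + 8 * (1 + φM) * m) * B) * (q - p) := by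
  have hM := H.pos
  have hC0 : 0 ≤ C := (abs_nonneg _).trans (hC 0)
  obtain ⟨Rt, hRt⟩ : ∃ Rt : ℝ, Rt = |p| + |q| + 1 := ⟨_, rfl⟩
  have hRt0 : 0 < Rt := by rw [hRt]; positivity
  let Ψ : Phase d → ℝ := fun z => Θ (1 + qd z)
  have hΨ : ContDiff ℝ 1 Ψ := hΘ.comp (contDiff_const.add qd_contDiff)
  let g : Phase d × ℝ → ℝ := fun y => Ψ y.1 * cut (y.2 / Rt)
  have hg : ContDiff ℝ 1 g := (hΨ.comp contDiff_fst).mul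
    (cut_contDiff.comp (contDiff_snd.div_const _))
  have hΨc : HasCompactSupport Ψ := radial_cs hR
  have hgc : HasCompactSupport g := by
    refine HasCompactSupport.intro (K := tsupport Ψ ×ˢ Icc (-(2 * Rt)) (2 * Rt))
      (hΨc.isCompact.prod isCompact_Icc) ?_
    rintro ⟨z, τ⟩ hy
    simp only [mem_prod, not_and_or] at hy
    rcases hy with hy | hy
    · simp [g, image_eq_zero_of_notMem_tsupport hy]
    · have : 2 ≤ |τ / Rt| := by
        rw [abs_div, abs_of_pos hRt0, le_div_iff₀ hRt0]
        by_contra hcon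
        rw [not_le, abs_lt] at hcon
        exact hy ⟨hcon.1.le, hcon.2.le⟩
      simp [g, cut_zero this]
  have hin : ∀ τ ∈ Ioo (-Rt) Rt, ∀ z, g (z, τ) = Ψ z := by
    intro τ hτ z
    have : |τ / Rt| ≤ 1 := by
      rw [abs_div, abs_of_pos hRt0, div_le_one hRt0, abs_le]
      exact ⟨hτ.1.le, hτ.2.le⟩
    simp [g, cut_one this]
  have hsub : Icc p q ⊆ Ioo (-Rt) Rt := by
    intro τ hτ
    constructor
    · linarith [neg_abs_le p, abs_nonneg q, hτ.1]
    · linarith [le_abs_self q, abs_nonneg p, hτ.2]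
  have hw := H.weakB hle hpq hB hg hgc
  simp only [hin q (hsub (right_mem_Icc.2 hle)), hin p (hsub (left_mem_Icc.2 hle))] at hw
  change |(∫ z, Ψ z ∂(μ q)) - (∫ z, Ψ z ∂(μ p))| ≤ _
  rw [hw, ← Real.norm_eq_abs]
  have := intervalIntegral.norm_integral_le_of_norm_le_const (a := p) (b := q)
    (f := fun s => ∫ z, TD φ μ g (s, z) ∂(μ s)) (C := C * ((1 + 8 * (1 + φM) * m) * B)) ?_
  · rwa [abs_of_nonneg (by linarith)] at this
  intro s hs
  rw [uIoc_of_le hle] at hs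
  have hs' : s ∈ Icc p q := ⟨hs.1.le, hs.2⟩
  have := H.fin (hpq hs')
  have hcp := H.cpt s (hpq hs')
  have hTD : ∀ z, TD φ μ g (s, z) = deriv Θ (1 + qd z) * dq z (bf φ (μ s) z) := by
    intro z
    rw [TD_congr (g' := fun y => Ψ y.1) isOpen_Ioo (fun z τ hτ => hin τ hτ z) (hsub hs')]
    unfold TD
    have h1 : HasFDerivAt (fun z : Phase d => 1 + qd z) (fderiv ℝ qd z) z :=
      ((qd_contDiff.differentiable one_ne_zero z).hasFDerivAt).const_add 1
    have h2 : HasDerivAt Θ (deriv Θ (1 + qd z)) (1 + qd z) :=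
      (hΘ.differentiable one_ne_zero _).hasDerivAt
    have h3 : HasFDerivAt Ψ (deriv Θ (1 + qd z) • fderiv ℝ qd z) z := h2.comp_hasFDerivAt z h1
    have h4 : HasFDerivAt (fun y : Phase d × ℝ => Ψ y.1)
      ((deriv Θ (1 + qd z) • fderiv ℝ qd z).comp (ContinuousLinearMap.fst ℝ (Phase d) ℝ)) (z, s) :=
      HasFDerivAt.comp (g := Ψ) (z, s) h3 hasFDerivAt_fst
    rw [h4.fderiv]
    simp [qd_fderiv]
  simp only [hTD]
  set m' := (μ s).real univ with hm'
  have hm0 : 0 ≤ m' := measureReal_nonneg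
  have hint : Integrable (fun z : Phase d => C * ((1 + qd z) +
      2 * ((1 + φM) * (3 * m' * (1 + qd z) + Nw (μ s))))) (μ s) :=
    integrable_of_cpt hcp (by have := @qd_cont d; fun_prop)
  refine (norm_integral_le_of_norm_le hint (Eventually.of_forall ?_)).trans ?_
  · intro z
    rw [norm_mul, Real.norm_eq_abs, Real.norm_eq_abs]
    have := dq_bf H.pos H.bd hcp z
    exact mul_le_mul (hC _) this (abs_nonneg _) hC0
  · have e : ∀ z : Phase d, C * ((1 + qd z) + 2 * ((1 + φM) * (3 * m' * (1 + qd z) + Nw (μ s))))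
        = (C * (1 + 6 * (1 + φM) * m')) * (1 + qd z) + C * 2 * (1 + φM) * Nw (μ s) := by
      intro z; ring
    simp only [e]
    rw [integral_add (integrable_of_cpt hcp (by have := @qd_cont d; fun_prop)) (integrable_const _),
      integral_const_mul, integral_const, smul_eq_mul]
    change _ * Nw (μ s) + m' * _ ≤ _
    have hN0 : 0 ≤ Nw (μ s) := Nw_nonneg
    calc _ = C * ((1 + 8 * (1 + φM) * m') * Nw (μ s)) := by ring
      _ ≤ _ := by
        have := hm s hs'
        have := hB s hs'
        have hmm : 0 ≤ m := hm0.trans (hm s hs')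
        gcongr


lemma trunc {d : ℕ} {μ : Measure (Phase d)} [IsFiniteMeasure μ] (h : MeasureCompactSupport μ) :
    ∃ R0 : ℝ, 0 < R0 ∧ ∀ R, R0 ≤ R → (∀ᵐ z ∂μ, cut ((1 + qd z) / R) = 1) := by
  obtain ⟨K, hK, hK0⟩ := h
  obtain ⟨W, hW⟩ := (hK.image (@w_cont d)).bddAbove
  refine ⟨max W 1, by positivity, ?_⟩
  intro R hR
  have : ∀ᵐ z ∂μ, z ∈ K := by rw [ae_iff]; exact hK0
  filter_upwards [this] with z hz
  apply cut_one
  have h1 : 1 + qd z ≤ W := hW ⟨z, hz, rfl⟩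
  have hR0 : 0 < R := lt_of_lt_of_le (by positivity) hR
  have := qd_nonneg z
  rw [abs_of_nonneg (by positivity), div_le_one hR0]
  exact h1.trans ((le_max_left _ _).trans hR)

lemma cutR_zero {R : ℝ} (hR : 0 < R) : ∀ u, 2 * R ≤ u → cut (u / R) = 0 := by
  intro u hu
  apply cut_zero
  rw [abs_div, abs_of_pos hR, le_div_iff₀ hR]
  exact hu.trans (le_abs_self u)

lemma Hyp.mass_bd {d : ℕ} {T : ℝ} {φ : ℝ → ℝ} {Kφ : NNReal} {φM : ℝ} {μ : ℝ → Measure (Phase d)}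
    (H : Hyp T φ Kφ φM μ) {t1 : ℝ} (ht1 : t1 < T) :
    ∃ m, ∀ t ∈ Icc 0 t1, (μ t).real univ ≤ m := by
  have hsub : Icc 0 t1 ⊆ Ico 0 T := fun t ht => ⟨ht.1, ht.2.trans_lt ht1⟩
  let Λ0 : Icc 0 t1 → ZeroAtInftyContinuousMap (Phase d) ℝ →ₗ[ℝ] ℝ := fun t =>
    { toFun := fun g => ∫ z, g z ∂(μ t)
      map_add' := by
        intro f g
        have := H.fin (hsub t.2)
        have hc := H.cpt t (hsub t.2)
        simp only [ZeroAtInftyContinuousMap.add_apply]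
        exact integral_add (integrable_of_cpt hc f.continuous) (integrable_of_cpt hc g.continuous)
      map_smul' := by
        intro c f
        simp only [ZeroAtInftyContinuousMap.smul_apply, smul_eq_mul, RingHom.id_apply]
        exact integral_const_mul _ _ }
  have hnorm : ∀ (f : ZeroAtInftyContinuousMap (Phase d) ℝ) z, ‖f z‖ ≤ ‖f‖ := by
    intro f z
    rw [← ZeroAtInftyContinuousMap.norm_toBCF_eq_norm]
    exact f.toBCF.norm_coe_le_norm z
  let Λ : Icc 0 t1 → ZeroAtInftyContinuousMap (Phase d) ℝ →L[ℝ] ℝ := fun t =>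
    (Λ0 t).mkContinuous ((μ t).real univ) (by
      intro f
      have := H.fin (hsub t.2)
      rw [mul_comm]
      exact norm_integral_le_of_norm_le_const (Eventually.of_forall (hnorm f)))
  obtain ⟨m, hm⟩ := banach_steinhaus (g := Λ) (by
    intro f
    have hcont : ContinuousOn (fun t => ∫ z, f z ∂(μ t)) (Icc 0 t1) := (H.sol.2.1 f).mono hsub
    obtain ⟨C, hC⟩ := isCompact_Icc.exists_bound_of_continuousOn hcont
    exact ⟨C, fun t => hC t t.2⟩)
  refine ⟨m, fun t ht => ?_⟩
  have := H.fin (hsub ht)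
  obtain ⟨R, hR0, hR⟩ := trunc (H.cpt t (hsub ht))
  have hR := hR R le_rfl
  let f : ZeroAtInftyContinuousMap (Phase d) ℝ :=
    ⟨⟨fun z => cut ((1 + qd z) / R), cut_cont.comp (w_cont.div_const _)⟩,
      (radial_cs (Θ := fun u => cut (u / R)) (cutR_zero hR0)).is_zero_at_infty⟩
  have h1 : Λ ⟨t, ht⟩ f = (μ t).real univ := by
    change ∫ z, cut ((1 + qd z) / R) ∂(μ t) = _
    rw [integral_congr_ae hR]
    simp
  have h2 : ‖f‖ ≤ 1 := by
    rw [← ZeroAtInftyContinuousMap.norm_toBCF_eq_norm, BoundedContinuousFunction.norm_le zero_le_one]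
    intro z
    change ‖cut _‖ ≤ 1
    rw [Real.norm_eq_abs, abs_of_nonneg (cut_nonneg _)]
    exact cut_le_one _
  rw [← h1]
  calc Λ ⟨t, ht⟩ f ≤ ‖Λ ⟨t, ht⟩ f‖ := le_abs_self _
    _ ≤ ‖Λ ⟨t, ht⟩‖ * ‖f‖ := (Λ ⟨t, ht⟩).le_opNorm f
    _ ≤ m * 1 := mul_le_mul (hm _) h2 (norm_nonneg _) ((norm_nonneg _).trans (hm ⟨t, ht⟩))
    _ = m := mul_one m

lemma wcut_deriv : ∃ C, ∀ R : ℝ, 0 < R → ∀ u, |deriv (fun u => u * cut (u / R)) u| ≤ C := by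
  have h1 : ContDiff ℝ 1 (fun u => u * cut u) := contDiff_id.mul cut_contDiff
  have h2 : HasCompactSupport (fun u => u * cut u) := cut_cs.mul_left
  obtain ⟨C, hC⟩ := h2.deriv.exists_bound_of_continuous (h1.continuous_deriv le_rfl)
  refine ⟨C, fun R hR u => ?_⟩
  have h3 : HasDerivAt (fun u => u * cut u) (deriv (fun u => u * cut u) (u / R)) (u / R) :=
    (h1.differentiable one_ne_zero _).hasDerivAt
  have h4 : HasDerivAt (fun u => R * ((u / R) * cut (u / R)))
      (R * (deriv (fun u => u * cut u) (u / R) * (1 / R))) u :=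
    (HasDerivAt.comp (h₂ := fun u => u * cut u) u h3 ((hasDerivAt_id u).div_const R)).const_mul R
  have e : (fun u => R * ((u / R) * cut (u / R))) = fun u => u * cut (u / R) := by
    funext u; field_simp
  rw [e] at h4
  rw [h4.deriv]
  have : R * (deriv (fun u => u * cut u) (u / R) * (1 / R)) = deriv (fun u => u * cut u) (u / R) := by
    field_simp
  rw [this]
  exact hC _

lemma cut_deriv : ∃ C, ∀ R : ℝ, 0 < R → ∀ u, |deriv (fun u => cut (u / R)) u| ≤ C / R := by
  obtain ⟨C, hC⟩ := cut_cs.deriv.exists_bound_of_continuous (cut_contDiff.continuous_deriv le_rfl)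
  refine ⟨C, fun R hR u => ?_⟩
  have h3 : HasDerivAt cut (deriv cut (u / R)) (u / R) :=
    (cut_contDiff.differentiable one_ne_zero _).hasDerivAt
  have h4 := HasDerivAt.comp (h₂ := cut) u h3 ((hasDerivAt_id u).div_const R)
  change |deriv (cut ∘ fun u => u / R) u| ≤ _
  have h5 : deriv (cut ∘ fun u => u / R) u = deriv cut (u / R) * (1 / R) := h4.deriv
  rw [h5, abs_mul, abs_of_pos (by positivity : 0 < 1 / R), mul_one_div]
  gcongr
  exact hC _

lemma wcut_int {d : ℕ} {μ : Measure (Phase d)} {R : ℝ}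
    (h : ∀ᵐ z ∂μ, cut ((1 + qd z) / R) = 1) :
    ∫ z, (1 + qd z) * cut ((1 + qd z) / R) ∂μ = Nw μ := by
  apply integral_congr_ae
  filter_upwards [h] with z hz
  simp [hz]

lemma wcut_le {d : ℕ} {μ : Measure (Phase d)} [IsFiniteMeasure μ] (h : MeasureCompactSupport μ)
    (R : ℝ) : ∫ z, (1 + qd z) * cut ((1 + qd z) / R) ∂μ ≤ Nw μ := by
  have h1 : Continuous fun z : Phase d => (1 + qd z) * cut ((1 + qd z) / R) :=
    w_cont.mul (cut_cont.comp (w_cont.div_const _))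
  apply integral_mono (integrable_of_cpt h h1) (integrable_of_cpt h w_cont)
  intro z
  have := qd_nonneg z
  exact mul_le_of_le_one_right (by linarith) (cut_le_one _)

lemma Hyp.N_closed {d : ℕ} {T : ℝ} {φ : ℝ → ℝ} {Kφ : NNReal} {φM : ℝ} {μ : ℝ → Measure (Phase d)}
    (H : Hyp T φ Kφ φM μ) {t1 : ℝ} (ht1 : t1 < T) (B : ℝ) :
    IsClosed {t | t ∈ Icc 0 t1 ∧ Nw (μ t) ≤ B} := by
  have hsub : Icc 0 t1 ⊆ Ico 0 T := fun t ht => ⟨ht.1, ht.2.trans_lt ht1⟩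
  have e : {t | t ∈ Icc 0 t1 ∧ Nw (μ t) ≤ B} = ⋂ n : ℕ, (Icc 0 t1 ∩
      (fun t => ∫ z, (1 + qd z) * cut ((1 + qd z) / (n + 1)) ∂(μ t)) ⁻¹' Iic B) := by
    ext t
    simp only [mem_setOf_eq, mem_iInter, mem_inter_iff, mem_preimage, mem_Iic]
    constructor
    · rintro ⟨ht, hB⟩ n
      have := H.fin (hsub ht)
      exact ⟨ht, (wcut_le (H.cpt t (hsub ht)) _).trans hB⟩
    · intro h
      have ht := (h 0).1
      have := H.fin (hsub ht)
      obtain ⟨R, hR0, hR⟩ := trunc (H.cpt t (hsub ht))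
      obtain ⟨n, hn⟩ := exists_nat_gt R
      have h2 := (h n).2
      rw [wcut_int (hR (n + 1) (by linarith))] at h2
      exact ⟨ht, h2⟩
  rw [e]
  refine isClosed_iInter fun n => ?_
  refine ContinuousOn.preimage_isClosed_of_isClosed ?_ isClosed_Icc isClosed_Iic
  refine (H.cont_cs (g := fun z => (1 + qd z) * cut ((1 + qd z) / (n + 1)))
    (w_cont.mul (cut_cont.comp (w_cont.div_const _))) ?_).mono hsub
  exact HasCompactSupport.mul_left (radial_cs (Θ := fun u => cut (u / (n + 1)))
    (cutR_zero (by positivity)))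

lemma Hyp.N_lip {d : ℕ} {T : ℝ} {φ : ℝ → ℝ} {Kφ : NNReal} {φM : ℝ} {μ : ℝ → Measure (Phase d)}
    (H : Hyp T φ Kφ φM μ) {t1 : ℝ} (ht1 : t1 < T) :
    ∃ c, 0 < c ∧ ∀ p q B, 0 ≤ p → p ≤ q → q ≤ t1 → (∀ σ ∈ Icc p q, Nw (μ σ) ≤ B) →
      |Nw (μ q) - Nw (μ p)| ≤ c * B * (q - p) := by
  obtain ⟨m, hm⟩ := H.mass_bd ht1
  obtain ⟨C, hC⟩ := wcut_deriv
  refine ⟨|C * (1 + 8 * (1 + φM) * m)| + 1, by positivity, ?_⟩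
  intro p q B hp hpq hq hB
  have hsub : Icc p q ⊆ Ico 0 T := fun t ht => ⟨hp.trans ht.1, (ht.2.trans hq).trans_lt ht1⟩
  have := H.fin (hsub (left_mem_Icc.2 hpq))
  have := H.fin (hsub (right_mem_Icc.2 hpq))
  obtain ⟨R1, hR1, h1⟩ := trunc (H.cpt p (hsub (left_mem_Icc.2 hpq)))
  obtain ⟨R2, hR2, h2⟩ := trunc (H.cpt q (hsub (right_mem_Icc.2 hpq)))
  set R := max R1 R2
  have hR : 0 < R := lt_of_lt_of_le hR1 (le_max_left _ _)
  have := H.radial hpq hsub hB (fun σ hσ => hm σ ⟨hp.trans hσ.1, hσ.2.trans hq⟩)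
    (Θ := fun u => u * cut (u / R)) (contDiff_id.mul (cut_contDiff.comp (contDiff_id.div_const _)))
    (R := 2 * R) (fun u hu => by simp [cutR_zero hR u hu]) (hC R hR)
  rw [wcut_int (h1 R (le_max_left _ _)), wcut_int (h2 R (le_max_right _ _))] at this
  refine this.trans ?_
  have hB0 : 0 ≤ B := Nw_nonneg.trans (hB p (left_mem_Icc.2 hpq))
  have hqp : 0 ≤ q - p := by linarith
  rw [← mul_assoc C]
  gcongr
  linarith [le_abs_self (C * (1 + 8 * (1 + φM) * m))]

/-- topological bootstrap -/
lemma bootstrap {N : ℝ → ℝ} {t1 c : ℝ} (hN : ∀ t, 0 ≤ N t) (hc : 0 < c)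
    (hcl : ∀ B, IsClosed {t | t ∈ Icc 0 t1 ∧ N t ≤ B})
    (hlip : ∀ p q B, 0 ≤ p → p ≤ q → q ≤ t1 → (∀ σ ∈ Icc p q, N σ ≤ B) →
      |N q - N p| ≤ c * B * (q - p)) :
    ∃ B, ∀ t ∈ Icc 0 t1, N t ≤ B := by
  obtain ⟨δ, hδ⟩ : ∃ δ, δ = 1 / (2 * c) := ⟨_, rfl⟩
  have hδ0 : 0 < δ := by rw [hδ]; positivity
  have hcδ : c * δ = 1 / 2 := by rw [hδ]; field_simp
  -- doubling under boundedness
  have D : ∀ p q B, 0 ≤ p → q ≤ t1 → q - p ≤ δ → (∀ σ ∈ Icc p q, N σ ≤ B) →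
      ∀ τ ∈ Icc p q, ∀ τ' ∈ Icc p q, N τ ≤ 2 * N τ' := by
    intro p q B hp hq hpq hB τ hτ τ' hτ'
    have hbdd : BddAbove (N '' Icc p q) := ⟨B, by rintro _ ⟨σ, hσ, rfl⟩; exact hB σ hσ⟩
    have hne : (N '' Icc p q).Nonempty := ⟨_, τ, hτ, rfl⟩
    set S := sSup (N '' Icc p q) with hS
    have hle : ∀ σ ∈ Icc p q, N σ ≤ S := fun σ hσ => le_csSup hbdd ⟨σ, hσ, rfl⟩
    have hS0 : 0 ≤ S := (hN τ).trans (hle τ hτ)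
    have main : ∀ σ ∈ Icc p q, N σ ≤ N τ' + S / 2 := by
      intro σ hσ
      have key : |N σ - N τ'| ≤ S / 2 := by
        rcases le_total σ τ' with h | h
        · have := hlip σ τ' S (hp.trans hσ.1) h (hτ'.2.trans hq)
            (fun r hr => hle r ⟨hσ.1.trans hr.1, hr.2.trans hτ'.2⟩)
          rw [abs_sub_comm]
          have h3 : τ' - σ ≤ δ := by linarith [hσ.1, hτ'.2]
          calc _ ≤ c * S * (τ' - σ) := this
            _ ≤ c * S * δ := by gcongr
            _ = (c * δ) * S := by ring
            _ = S / 2 := by rw [hcδ]; ring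
        · have := hlip τ' σ S (hp.trans hτ'.1) h (hσ.2.trans hq)
            (fun r hr => hle r ⟨hτ'.1.trans hr.1, hr.2.trans hσ.2⟩)
          have h3 : σ - τ' ≤ δ := by linarith [hσ.2, hτ'.1]
          calc _ ≤ c * S * (σ - τ') := this
            _ ≤ c * S * δ := by gcongr
            _ = (c * δ) * S := by ring
            _ = S / 2 := by rw [hcδ]; ring
      linarith [(abs_le.1 key).2]
    have : S ≤ N τ' + S / 2 := csSup_le hne (by rintro _ ⟨σ, hσ, rfl⟩; exact main σ hσ)
    linarith [hle τ hτ]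
  -- bad set
  let LB : ℝ → Prop := fun t => ∃ ε > 0, ∃ B, ∀ σ ∈ Icc 0 t1, |σ - t| < ε → N σ ≤ B
  have hcompact : ∀ p q, 0 ≤ p → q ≤ t1 → (∀ t ∈ Icc p q, LB t) → ∃ B, ∀ σ ∈ Icc p q, N σ ≤ B := by
    intro p q hp hq h
    refine isCompact_Icc.induction_on (p := fun s => ∃ B, ∀ σ ∈ s ∩ Icc p q, N σ ≤ B)
      ⟨0, by simp⟩ ?_ ?_ ?_ |>.imp (fun B hB σ hσ => hB σ ⟨hσ, hσ⟩)
    · rintro s t hst ⟨B, hB⟩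
      exact ⟨B, fun σ hσ => hB σ ⟨hst hσ.1, hσ.2⟩⟩
    · rintro s t ⟨B, hB⟩ ⟨B', hB'⟩
      refine ⟨max B B', ?_⟩
      rintro σ ⟨hσ | hσ, h2⟩
      · exact (hB σ ⟨hσ, h2⟩).trans (le_max_left _ _)
      · exact (hB' σ ⟨hσ, h2⟩).trans (le_max_right _ _)
    · intro x hx
      obtain ⟨ε, hε, B, hB⟩ := h x hx
      refine ⟨Metric.ball x ε, mem_nhdsWithin_of_mem_nhds (Metric.ball_mem_nhds x hε), B, ?_⟩
      rintro σ ⟨hσ, h2⟩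
      exact hB σ ⟨hp.trans h2.1, h2.2.trans hq⟩ hσ
  have E : ∀ p q, 0 ≤ p → p < q → q ≤ t1 → q - p ≤ δ → (∀ t ∈ Ioo p q, LB t) →
      N q ≤ 2 * N p ∧ N p ≤ 2 * N q := by
    intro p q hp hpq hq hd h
    set m0 := (p + q) / 2 with hm0
    have h1 : ∀ σ ∈ Ioo p q, N σ ≤ 2 * N m0 := by
      intro σ hσ
      have hex : ∃ B, ∀ σ' ∈ Icc (min σ m0) (max σ m0), N σ' ≤ B := by
        apply hcompact
        · exact le_min (by linarith [hσ.1]) (by linarith)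
        · exact max_le (by linarith [hσ.2]) (by linarith)
        · intro t ht
          have : max σ m0 < q := max_lt hσ.2 (by linarith)
          have : p < min σ m0 := lt_min hσ.1 (by linarith)
          exact h t ⟨by linarith [ht.1], by linarith [ht.2]⟩
      obtain ⟨B, hB⟩ := hex
      refine D (min σ m0) (max σ m0) B ?_ ?_ ?_ hB σ ⟨min_le_left _ _, le_max_left _ _⟩ m0
        ⟨min_le_right _ _, le_max_right _ _⟩
      · exact le_min (by linarith [hσ.1]) (by linarith)
      · exact max_le (by linarith [hσ.2]) (by linarith)
      · have : max σ m0 ≤ q := max_le hσ.2.le (by linarith)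
        have : p ≤ min σ m0 := le_min hσ.1.le (by linarith)
        linarith
    have h2 : Icc p q ⊆ {t | t ∈ Icc 0 t1 ∧ N t ≤ 2 * N m0} := by
      rw [← closure_Ioo hpq.ne]
      refine closure_minimal ?_ (hcl _)
      intro σ hσ
      exact ⟨⟨by linarith [hσ.1], by linarith [hσ.2]⟩, h1 σ hσ⟩
    have h3 := D p q _ hp hq hd (fun σ hσ => (h2 hσ).2)
    exact ⟨h3 q (right_mem_Icc.2 hpq.le) p (left_mem_Icc.2 hpq.le),
      h3 p (left_mem_Icc.2 hpq.le) q (right_mem_Icc.2 hpq.le)⟩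
  suffices hall : ∀ t ∈ Icc 0 t1, LB t from hcompact 0 t1 le_rfl le_rfl hall
  by_contra hbad
  push Not at hbad
  let C : Set ℝ := {t | t ∈ Icc 0 t1 ∧ ¬ LB t}
  have hCcl : IsClosed C := by
    have : C = Icc 0 t1 ∩ {t | LB t}ᶜ := rfl
    rw [this]
    refine isClosed_Icc.inter (isClosed_compl_iff.2 ?_)
    rw [Metric.isOpen_iff]
    rintro t ⟨ε, hε, B, hB⟩
    refine ⟨ε / 2, by positivity, ?_⟩
    intro s hs
    refine ⟨ε / 2, by positivity, B, fun σ hσ h => hB σ hσ ?_⟩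
    rw [Metric.mem_ball, Real.dist_eq] at hs
    calc |σ - t| = |(σ - s) + (s - t)| := by ring_nf
      _ ≤ |σ - s| + |s - t| := abs_add_le _ _
      _ < ε := by linarith
  have : CompleteSpace C := hCcl.completeSpace_coe
  have : Nonempty C := by
    obtain ⟨t, ht, h⟩ := hbad
    exact ⟨⟨t, ht, h⟩⟩
  obtain ⟨n, ⟨x, hx⟩⟩ := nonempty_interior_of_iUnion_of_closed
    (f := fun n : ℕ => {t : C | N t ≤ n}) (by
      intro n
      have : {t : C | N t ≤ n} = Subtype.val ⁻¹' {t | t ∈ Icc 0 t1 ∧ N t ≤ n} := by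
        ext t; simp only [mem_setOf_eq, mem_preimage]
        exact ⟨fun h => ⟨t.2.1, h⟩, fun h => h.2⟩
      rw [this]
      exact (hcl n).preimage continuous_subtype_val) (by
      ext t
      simp only [mem_iUnion, mem_setOf_eq, mem_univ, iff_true]
      exact exists_nat_ge _)
  rw [mem_interior_iff_mem_nhds, Metric.mem_nhds_iff] at hx
  obtain ⟨ε, hε, hx⟩ := hx
  have hCn : ∀ t ∈ C, |t - x| < ε → N t ≤ n := fun t ht h => hx (show (⟨t, ht⟩ : C) ∈ _ from h)
  apply x.2.2
  refine ⟨min ε δ, by positivity, 2 * n, ?_⟩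
  intro σ hσ hd
  have hn0 : (0:ℝ) ≤ n := Nat.cast_nonneg n
  have hd1 : |σ - x| < ε := hd.trans_le (min_le_left _ _)
  have hd2 : |σ - x| < δ := hd.trans_le (min_le_right _ _)
  by_cases hσC : σ ∈ C
  · linarith [hCn σ hσC hd1]
  have hxσ : (x : ℝ) ≠ σ := fun h => hσC (h ▸ x.2)
  rw [abs_lt] at hd1 hd2
  rcases lt_or_gt_of_ne hxσ with h | h
  · -- x < σ
    have hcp : IsCompact (C ∩ Icc (x:ℝ) σ) := isCompact_Icc.inter_left hCcl
    have hne : (C ∩ Icc (x:ℝ) σ).Nonempty := ⟨x, x.2, le_rfl, h.le⟩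
    obtain ⟨a, ha⟩ := hcp.exists_isGreatest hne
    have haσ : a < σ := lt_of_le_of_ne ha.1.2.2 (fun h => hσC (h ▸ ha.1.1))
    have := (E a σ ha.1.1.1.1 haσ hσ.2 (by linarith [ha.1.2.1]) ?_).1
    · have h3 := hCn a ha.1.1 (by rw [abs_lt]; constructor <;> linarith [ha.1.2.1])
      linarith
    · intro t ht
      by_contra hLB
      have : t ∈ C ∩ Icc (x:ℝ) σ := ⟨⟨⟨by linarith [ha.1.1.1.1, ht.1], by linarith [ht.2, hσ.2]⟩, hLB⟩,
        by linarith [ha.1.2.1, ht.1], ht.2.le⟩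
      linarith [ha.2 this, ht.1]
  · have hcp : IsCompact (C ∩ Icc σ (x:ℝ)) := isCompact_Icc.inter_left hCcl
    have hne : (C ∩ Icc σ (x:ℝ)).Nonempty := ⟨x, x.2, h.le, le_rfl⟩
    obtain ⟨a, ha⟩ := hcp.exists_isLeast hne
    have haσ : σ < a := lt_of_le_of_ne ha.1.2.1 (fun h => hσC (h ▸ ha.1.1))
    have := (E σ a hσ.1 haσ ha.1.1.1.2 (by linarith [ha.1.2.2]) ?_).2
    · have h3 := hCn a ha.1.1 (by rw [abs_lt]; constructor <;> linarith [ha.1.2.2])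
      linarith
    · intro t ht
      by_contra hLB
      have : t ∈ C ∩ Icc σ (x:ℝ) := ⟨⟨⟨by linarith [hσ.1, ht.1], by linarith [ha.1.1.1.2, ht.2]⟩, hLB⟩,
        ht.1.le, by linarith [ha.1.2.2, ht.2]⟩
      linarith [ha.2 this, ht.2]

lemma Hyp.N_bd {d : ℕ} {T : ℝ} {φ : ℝ → ℝ} {Kφ : NNReal} {φM : ℝ} {μ : ℝ → Measure (Phase d)}
    (H : Hyp T φ Kφ φM μ) {t1 : ℝ} (ht1 : t1 < T) : ∃ B, ∀ t ∈ Icc 0 t1, Nw (μ t) ≤ B := by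
  obtain ⟨c, hc, hl⟩ := H.N_lip ht1
  exact bootstrap (N := fun t => Nw (μ t)) (fun t => Nw_nonneg) hc (H.N_closed ht1) hl

lemma Hyp.mass_const {d : ℕ} {T : ℝ} {φ : ℝ → ℝ} {Kφ : NNReal} {φM : ℝ} {μ : ℝ → Measure (Phase d)}
    (H : Hyp T φ Kφ φM μ) {p q : ℝ} (hp : 0 ≤ p) (hpq : p ≤ q) (hq : q < T) :
    (μ q).real univ = (μ p).real univ := by
  obtain ⟨B, hB⟩ := H.N_bd hq
  obtain ⟨C, hC⟩ := cut_deriv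
  have hsub : Icc p q ⊆ Ico 0 T := fun t ht => ⟨hp.trans ht.1, ht.2.trans_lt hq⟩
  have hB' : ∀ σ ∈ Icc p q, Nw (μ σ) ≤ B := fun σ hσ => hB σ ⟨hp.trans hσ.1, hσ.2⟩
  have hm' : ∀ σ ∈ Icc p q, (μ σ).real univ ≤ B := fun σ hσ => by
    have := H.fin (hsub hσ)
    exact (mass_le_Nw (H.cpt σ (hsub hσ))).trans (hB' σ hσ)
  have := H.fin (hsub (left_mem_Icc.2 hpq))
  have := H.fin (hsub (right_mem_Icc.2 hpq))
  obtain ⟨R1, hR1, h1⟩ := trunc (H.cpt p (hsub (left_mem_Icc.2 hpq)))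
  obtain ⟨R2, hR2, h2⟩ := trunc (H.cpt q (hsub (right_mem_Icc.2 hpq)))
  have key : ∀ᶠ R in atTop, |(μ q).real univ - (μ p).real univ| ≤
      (C * ((1 + 8 * (1 + φM) * B) * B) * (q - p)) * R⁻¹ := by
    filter_upwards [eventually_ge_atTop R1, eventually_ge_atTop R2] with R hr1 hr2
    have hR : 0 < R := hR1.trans_le hr1
    have := H.radial hpq hsub hB' hm'
      (Θ := fun u => cut (u / R)) (cut_contDiff.comp (contDiff_id.div_const _))
      (R := 2 * R) (cutR_zero hR) (hC R hR)
    rw [integral_congr_ae (h1 R hr1), integral_congr_ae (h2 R hr2)] at this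
    simp only [integral_const, smul_eq_mul, mul_one] at this
    refine this.trans (le_of_eq ?_)
    ring
  have hlim : Tendsto (fun R : ℝ => (C * ((1 + 8 * (1 + φM) * B) * B) * (q - p)) * R⁻¹) atTop
      (nhds ((C * ((1 + 8 * (1 + φM) * B) * B) * (q - p)) * 0)) :=
    tendsto_inv_atTop_zero.const_mul _
  rw [mul_zero] at hlim
  have := ge_of_tendsto hlim key
  have := abs_nonpos_iff.1 this
  linarith


lemma gron {a b c : ℝ} {f f' : ℝ → ℝ} (hf : ∀ τ ∈ Icc a b, HasDerivWithinAt f (f' τ) (Icc a b) τ)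
    (hb : ∀ τ ∈ Icc a b, |f' τ| ≤ c * f τ) {s t : ℝ} (hs : s ∈ Icc a b) (ht : t ∈ Icc a b) :
    f t ≤ f s * Real.exp (c * |t - s|) := by
  have key : ∀ k : ℝ, ∀ τ ∈ Icc a b, HasDerivWithinAt (fun τ => Real.exp (k * τ) * f τ)
      (Real.exp (k * τ) * (k * f τ + f' τ)) (Icc a b) τ := by
    intro k τ hτ
    have h1 : HasDerivWithinAt (fun τ => Real.exp (k * τ)) (Real.exp (k * τ) * (k * 1)) (Icc a b) τ :=
      (((hasDerivAt_id τ).const_mul k).exp).hasDerivWithinAt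
    refine (h1.mul (hf τ hτ)).congr_deriv ?_
    ring
  have hcont : ∀ k : ℝ, ContinuousOn (fun τ => Real.exp (k * τ) * f τ) (Icc a b) :=
    fun k τ hτ => (key k τ hτ).continuousWithinAt
  have hmul : ∀ u : ℝ, Real.exp (c * u) * Real.exp (-(c * u)) = 1 := by
    intro u; rw [← Real.exp_add]; simp
  rcases le_total s t with h | h
  · have hanti : AntitoneOn (fun τ => Real.exp ((-c) * τ) * f τ) (Icc a b) := by
      apply antitoneOn_of_hasDerivWithinAt_nonpos (convex_Icc a b) (hcont _)
        (fun τ hτ => (key _ τ (interior_subset hτ)).mono interior_subset)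
      intro τ hτ
      have := (abs_le.1 (hb τ (interior_subset hτ))).2
      exact mul_nonpos_of_nonneg_of_nonpos (Real.exp_pos _).le (by linarith)
    have h2 := hanti hs ht h
    simp only at h2
    rw [abs_of_nonneg (sub_nonneg.2 h)]
    have h3 := mul_le_mul_of_nonneg_left h2 (Real.exp_pos (c * t)).le
    calc f t = Real.exp (c * t) * (Real.exp (-c * t) * f t) := by
          rw [← mul_assoc, neg_mul, hmul, one_mul]
      _ ≤ _ := h3
      _ = f s * (Real.exp (c * t) * Real.exp (-c * s)) := by ring
      _ = _ := by rw [← Real.exp_add]; ring_nf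
  · have hmono : MonotoneOn (fun τ => Real.exp (c * τ) * f τ) (Icc a b) := by
      apply monotoneOn_of_hasDerivWithinAt_nonneg (convex_Icc a b) (hcont _)
        (fun τ hτ => (key _ τ (interior_subset hτ)).mono interior_subset)
      intro τ hτ
      have := (abs_le.1 (hb τ (interior_subset hτ))).1
      exact mul_nonneg (Real.exp_pos _).le (by linarith)
    have h2 := hmono ht hs h
    simp only at h2
    rw [abs_of_nonpos (sub_nonpos.2 h)]
    have h3 := mul_le_mul_of_nonneg_left h2 (Real.exp_pos (-(c * t))).le
    calc f t = Real.exp (-(c * t)) * (Real.exp (c * t) * f t) := by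
          rw [← mul_assoc, mul_comm (Real.exp _), hmul, one_mul]
      _ ≤ _ := h3
      _ = f s * (Real.exp (-(c * t)) * Real.exp (c * s)) := by ring
      _ = _ := by rw [← Real.exp_add]; ring_nf

def IsChar {d : ℕ} (φ : ℝ → ℝ) (μ : ℝ → Measure (Phase d)) (t1 : ℝ) (Y : ℝ → Phase d) : Prop :=
  ∀ τ ∈ Icc 0 t1, HasDerivWithinAt Y (bf φ (μ τ) (Y τ)) (Icc 0 t1) τ

lemma Hyp.curve_bd {d : ℕ} {T : ℝ} {φ : ℝ → ℝ} {Kφ : NNReal} {φM : ℝ}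
    {μ : ℝ → Measure (Phase d)}
    (H : Hyp T φ Kφ φM μ) {t1 B : ℝ} (ht1 : t1 < T)
    (hB : ∀ σ ∈ Icc 0 t1, Nw (μ σ) ≤ B) {Y : ℝ → Phase d} (hY : IsChar φ μ t1 Y)
    {s t : ℝ} (hs : s ∈ Icc 0 t1) (ht : t ∈ Icc 0 t1) :
    1 + qd (Y t) ≤ (1 + qd (Y s)) * Real.exp ((1 + 8 * (1 + φM) * B) * |t - s|) := by
  refine gron (f := fun τ => 1 + qd (Y τ)) (f' := fun τ => dq (Y τ) (bf φ (μ τ) (Y τ)))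
    (fun τ hτ => (qd_hasDerivWithinAt (hY τ hτ)).const_add 1) ?_ hs ht
  intro τ hτ
  have hτ' : τ ∈ Ico 0 T := ⟨hτ.1, hτ.2.trans_lt ht1⟩
  have := H.fin hτ'
  have h1 := dq_bf H.pos H.bd (H.cpt τ hτ') (Y τ)
  have h2 := mass_le_Nw (H.cpt τ hτ')
  have h3 := hB τ hτ
  have h4 := qd_nonneg (Y τ)
  have h5 := H.pos
  have h6 : 0 ≤ (μ τ).real univ := measureReal_nonneg
  refine h1.trans ?_
  have h7 : 3 * (μ τ).real univ * (1 + qd (Y τ)) + Nw (μ τ) ≤ 4 * B * (1 + qd (Y τ)) := by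
    have : (μ τ).real univ * (1 + qd (Y τ)) ≤ B * (1 + qd (Y τ)) := by gcongr; linarith
    nlinarith
  have h8 := mul_le_mul_of_nonneg_left h7 (by linarith : 0 ≤ 2 * (1 + φM))
  linarith

lemma Hyp.curve_diff {d : ℕ} {T : ℝ} {φ : ℝ → ℝ} {Kφ : NNReal} {φM : ℝ}
    {μ : ℝ → Measure (Phase d)}
    (H : Hyp T φ Kφ φM μ) {t1 B : ℝ} (ht1 : t1 < T)
    (hB : ∀ σ ∈ Icc 0 t1, Nw (μ σ) ≤ B) {Y Y' : ℝ → Phase d} (hY : IsChar φ μ t1 Y)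
    (hY' : IsChar φ μ t1 Y') {ρ : ℝ} (hρ : ∀ τ ∈ Icc 0 t1, 1 + qd (Y τ) ≤ ρ)
    {s t : ℝ} (hs : s ∈ Icc 0 t1) (ht : t ∈ Icc 0 t1) :
    qd (Y t - Y' t) ≤ qd (Y s - Y' s) *
      Real.exp ((1 + 3 * ((1 + φM) * B + Kφ * (B + ρ * B))) * |t - s|) := by
  refine gron (f := fun τ => qd (Y τ - Y' τ))
    (fun τ hτ => qd_hasDerivWithinAt ((hY τ hτ).sub (hY' τ hτ))) ?_ hs ht
  intro τ hτ
  have hτ' : τ ∈ Ico 0 T := ⟨hτ.1, hτ.2.trans_lt ht1⟩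
  have := H.fin hτ'
  exact dq_bf_sub H.lip H.pos H.bd (H.cpt τ hτ') (hB τ hτ) _ _ (hρ τ hτ)

lemma Hyp.curve_ext {d : ℕ} {T : ℝ} {φ : ℝ → ℝ} {Kφ : NNReal} {φM : ℝ}
    {μ : ℝ → Measure (Phase d)}
    (H : Hyp T φ Kφ φM μ) {t1 B : ℝ} (h0 : 0 ≤ t1) (ht1 : t1 < T)
    (hB : ∀ σ ∈ Icc 0 t1, Nw (μ σ) ≤ B) {Y : ℝ → Phase d} (hY : IsChar φ μ t1 Y) :
    ∃ Z : ℝ → Phase d, ContDiff ℝ 1 Z ∧ (∀ τ ∈ Icc 0 t1, Z τ = Y τ) ∧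
      ∀ τ ∈ Icc 0 t1, HasDerivAt Z (bf φ (μ τ) (Z τ)) τ := by
  have hYc : ContinuousOn Y (Icc 0 t1) := fun τ hτ => (hY τ hτ).continuousWithinAt
  have hpq : Icc 0 t1 ⊆ Ico 0 T := fun τ hτ => ⟨hτ.1, hτ.2.trans_lt ht1⟩
  have hQ := H.herdQ_cont hpq hB
  have hβ : ContinuousOn (fun σ => bf φ (μ σ) (Y σ)) (Icc 0 t1) := by
    unfold bf
    refine ContinuousOn.prodMk (continuous_snd.comp_continuousOn hYc) ?_
    exact hQ.comp (f := fun σ => (σ, Y σ)) (continuousOn_id.prodMk hYc) (fun σ hσ => ⟨hσ, mem_univ _⟩)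
  set β : ℝ → Phase d := IccExtend h0 ((Icc 0 t1).domRestrict (fun σ => bf φ (μ σ) (Y σ))) with hβd
  have hβc : Continuous β := (continuousOn_iff_continuous_domRestrict.1 hβ).Icc_extend'
  have hβe : ∀ τ ∈ Icc 0 t1, β τ = bf φ (μ τ) (Y τ) := by
    intro τ hτ
    rw [hβd, IccExtend_of_mem _ _ hτ]; rfl
  set Z : ℝ → Phase d := fun τ => Y 0 + ∫ σ in (0:ℝ)..τ, β σ with hZ
  have hZd : ∀ τ, HasDerivAt Z (β τ) τ := fun τ =>
    (intervalIntegral.integral_hasDerivAt_right (hβc.intervalIntegrable _ _)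
      (hβc.stronglyMeasurableAtFilter _ _) hβc.continuousAt).const_add _
  have hZe : ∀ τ ∈ Icc 0 t1, Z τ = Y τ := by
    intro τ hτ
    have h1 : ∫ σ in (0:ℝ)..τ, β σ = Y τ - Y 0 := by
      apply intervalIntegral.integral_eq_sub_of_hasDerivAt_of_le hτ.1
        (hYc.mono (Icc_subset_Icc_right hτ.2)) _ (hβc.intervalIntegrable _ _)
      intro σ hσ
      have hσ' : σ ∈ Icc 0 t1 := ⟨hσ.1.le, hσ.2.le.trans hτ.2⟩
      rw [hβe σ hσ']
      exact (hY σ hσ').hasDerivAt (Icc_mem_nhds hσ.1 (hσ.2.trans_le hτ.2))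
    simp [hZ, h1]
  refine ⟨Z, ?_, hZe, ?_⟩
  · rw [contDiff_one_iff_deriv]
    refine ⟨fun τ => (hZd τ).differentiableAt, ?_⟩
    have : deriv Z = β := funext fun τ => (hZd τ).deriv
    rwa [this]
  · intro τ hτ
    rw [hZe τ hτ, ← hβe τ hτ]; exact hZd τ

lemma theta_exists (A : ℝ) : ∃ θ : ℝ → ℝ, ContDiff ℝ 1 θ ∧ Monotone θ ∧ (∀ u ≤ A, θ u = u) ∧
    ∃ A', ∀ u, A + 1 ≤ u → θ u = A' := by
  have hc : Continuous fun σ : ℝ => 1 - Real.smoothTransition (σ - A) :=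
    continuous_const.sub (Real.smoothTransition.continuous.comp (by fun_prop))
  have hd : ∀ u : ℝ, HasDerivAt (fun u => A + ∫ σ in A..u, (1 - Real.smoothTransition (σ - A)))
      (1 - Real.smoothTransition (u - A)) u := fun u =>
    (intervalIntegral.integral_hasDerivAt_right (hc.intervalIntegrable _ _)
      (hc.stronglyMeasurableAtFilter _ _) hc.continuousAt).const_add _
  refine ⟨fun u => A + ∫ σ in A..u, (1 - Real.smoothTransition (σ - A)), ?_, ?_, ?_,
    A + ∫ σ in A..(A+1), (1 - Real.smoothTransition (σ - A)), ?_⟩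
  · rw [contDiff_one_iff_deriv]
    refine ⟨fun τ => (hd τ).differentiableAt, ?_⟩
    rw [show deriv _ = _ from funext fun τ => (hd τ).deriv]
    exact hc
  · apply monotone_of_deriv_nonneg (fun τ => (hd τ).differentiableAt)
    intro u
    rw [(hd u).deriv]
    linarith [Real.smoothTransition.le_one (u - A)]
  · intro u hu
    have : ∫ σ in A..u, (1 - Real.smoothTransition (σ - A)) = ∫ σ in A..u, (1:ℝ) := by
      apply intervalIntegral.integral_congr
      intro σ hσ
      rw [uIcc_of_ge hu] at hσ
      simp [Real.smoothTransition.zero_of_nonpos (sub_nonpos.2 hσ.2)]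
    simp [this]
  · intro u hu
    have h1 : ∫ σ in (A+1)..u, (1 - Real.smoothTransition (σ - A)) = 0 := by
      rw [show (0:ℝ) = ∫ σ in (A+1)..u, (0:ℝ) by simp]
      apply intervalIntegral.integral_congr
      intro σ hσ
      rw [uIcc_of_le hu] at hσ
      simp [Real.smoothTransition.one_of_one_le (by linarith [hσ.1] : 1 ≤ σ - A)]
    have := intervalIntegral.integral_add_adjacent_intervals (hc.intervalIntegrable A (A+1))
      (hc.intervalIntegrable (μ := volume) (A+1) u)
    simp only [h1, add_zero] at this
    simp [this]


def cc {d : ℕ} (a : Phase d → ℝ) (Z : Phase d → ℝ → Phase d) (M0 k r : ℝ) (y : Phase d)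
    (w : Phase d × ℝ) : ℝ := a y + M0 * Real.exp (-(k * (w.2 - r))) * qd (Z y w.2 - w.1)

def SS {d : ℕ} (a : Phase d → ℝ) (Z : Phase d → ℝ → Phase d) (M0 k r : ℝ) (F : Finset (Phase d))
    (K : ℝ) (w : Phase d × ℝ) : ℝ := ∑ y ∈ F, Real.exp (-(K * cc a Z M0 k r y w))

def GG {d : ℕ} (a : Phase d → ℝ) (Z : Phase d → ℝ → Phase d) (M0 k r : ℝ) (F : Finset (Phase d))
    (K : ℝ) (w : Phase d × ℝ) : ℝ := -(1 / K) * Real.log (SS a Z M0 k r F K w)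

lemma cc_contDiff {d : ℕ} {a : Phase d → ℝ} {Z : Phase d → ℝ → Phase d} {M0 k r : ℝ} {y : Phase d}
    (hZ : ContDiff ℝ 1 (Z y)) : ContDiff ℝ 1 (cc a Z M0 k r y) := by
  unfold cc
  refine contDiff_const.add (ContDiff.mul ?_ ?_)
  · fun_prop
  · exact qd_contDiff.comp ((hZ.comp contDiff_snd).sub contDiff_fst)

lemma SS_pos {d : ℕ} {a : Phase d → ℝ} {Z : Phase d → ℝ → Phase d} {M0 k r : ℝ}
    {F : Finset (Phase d)} (hF : F.Nonempty) {K : ℝ} (w : Phase d × ℝ) :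
    0 < SS a Z M0 k r F K w := Finset.sum_pos (fun _ _ => Real.exp_pos _) hF

lemma GG_contDiff {d : ℕ} {a : Phase d → ℝ} {Z : Phase d → ℝ → Phase d} {M0 k r : ℝ}
    {F : Finset (Phase d)} (hF : F.Nonempty) {K : ℝ}
    (hZ : ∀ y, ContDiff ℝ 1 (Z y)) : ContDiff ℝ 1 (GG a Z M0 k r F K) := by
  have h1 : ContDiff ℝ 1 (SS a Z M0 k r F K) :=
    ContDiff.sum fun y _ => ((contDiff_const.mul (cc_contDiff (hZ y))).neg).exp
  exact contDiff_const.mul (h1.log fun w => (SS_pos hF w).ne')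

lemma GG_lower {d : ℕ} {a : Phase d → ℝ} {Z : Phase d → ℝ → Phase d} {M0 k r : ℝ}
    {F : Finset (Phase d)} (hF : F.Nonempty) {K : ℝ} (hK : 0 < K) {w : Phase d × ℝ} {u : ℝ}
    (h : ∀ y ∈ F, u ≤ cc a Z M0 k r y w) : u - Real.log F.card / K ≤ GG a Z M0 k r F K w := by
  have hn : (0:ℝ) < F.card := by exact_mod_cast hF.card_pos
  have h1 : SS a Z M0 k r F K w ≤ F.card * Real.exp (-(K * u)) := by
    rw [← nsmul_eq_mul]
    refine Finset.sum_le_card_nsmul _ _ _ fun y hy => ?_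
    apply Real.exp_le_exp.2
    have := mul_le_mul_of_nonneg_left (h y hy) hK.le
    linarith
  have h2 := Real.log_le_log (SS_pos hF w) h1
  rw [Real.log_mul hn.ne' (Real.exp_pos _).ne', Real.log_exp] at h2
  unfold GG
  have h3 : u - Real.log F.card / K = -(1 / K) * (Real.log F.card + -(K * u)) := by
    field_simp; ring
  rw [h3]
  have : 0 < 1 / K := by positivity
  nlinarith

lemma GG_upper {d : ℕ} {a : Phase d → ℝ} {Z : Phase d → ℝ → Phase d} {M0 k r : ℝ}
    {F : Finset (Phase d)} {K : ℝ} (hK : 0 < K) {w : Phase d × ℝ} {y : Phase d}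
    (hy : y ∈ F) : GG a Z M0 k r F K w ≤ cc a Z M0 k r y w := by
  have h1 : Real.exp (-(K * cc a Z M0 k r y w)) ≤ SS a Z M0 k r F K w :=
    Finset.single_le_sum (f := fun y => Real.exp (-(K * cc a Z M0 k r y w)))
      (fun _ _ => (Real.exp_pos _).le) hy
  have h2 := Real.log_le_log (Real.exp_pos _) h1
  rw [Real.log_exp] at h2
  unfold GG
  have h3 : cc a Z M0 k r y w = -(1 / K) * (-(K * cc a Z M0 k r y w)) := by
    field_simp
  have : 0 < 1 / K := by positivity
  rw [h3]
  nlinarith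

lemma cc_line {d : ℕ} {a : Phase d → ℝ} {Z : Phase d → ℝ → Phase d} {M0 k r : ℝ} {y : Phase d}
    {σ : ℝ} {b b' z : Phase d} (hZ : HasDerivAt (Z y) b' σ) :
    HasDerivAt (fun ε : ℝ => cc a Z M0 k r y (z + ε • b, σ + ε))
      (M0 * Real.exp (-(k * (σ - r))) * (-k * qd (Z y σ - z) + dq (Z y σ - z) (b' - b))) 0 := by
  have h0 : HasDerivAt (fun ε : ℝ => σ + ε) 1 0 := (hasDerivAt_id (0:ℝ)).const_add σ
  have h2 : HasDerivAt (fun ε : ℝ => z + ε • b) b 0 := by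
    simpa using ((hasDerivAt_id (0:ℝ)).smul_const b).const_add z
  have h3 : HasDerivAt (fun ε : ℝ => Z y (σ + ε)) b' 0 := by
    have := HasDerivAt.scomp (0:ℝ) (g₁ := Z y) (h := fun ε : ℝ => σ + ε) (by simpa using hZ) h0
    simpa [Function.comp_def] using this
  have h4 := (qd_hasDerivWithinAt (s := univ) (h3.sub h2).hasDerivWithinAt).hasDerivAt univ_mem
  have h5 : HasDerivAt (fun ε : ℝ => M0 * Real.exp (-(k * (σ + ε - r))))
      (M0 * (Real.exp (-(k * (σ + 0 - r))) * (-(k * 1)))) 0 :=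
    ((((h0.sub_const r).const_mul k).neg).exp).const_mul M0
  have h6 := (h5.mul h4).const_add (a y)
  unfold cc
  refine h6.congr_deriv ?_
  simp only [Pi.sub_apply, add_zero, zero_smul]
  ring

lemma TD_of_line {d : ℕ} {φ : ℝ → ℝ} {μ : ℝ → Measure (Phase d)} {g : Phase d × ℝ → ℝ}
    (hg : ContDiff ℝ 1 g) {σ : ℝ} {z : Phase d} {v : ℝ}
    (h : HasDerivAt (fun ε : ℝ => g (z + ε • bf φ (μ σ) z, σ + ε)) v 0) : TD φ μ g (σ, z) = v := by
  have h0 : HasDerivAt (fun ε : ℝ => σ + ε) 1 0 := (hasDerivAt_id (0:ℝ)).const_add σ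
  have h2 : HasDerivAt (fun ε : ℝ => z + ε • bf φ (μ σ) z) (bf φ (μ σ) z) 0 := by
    simpa using ((hasDerivAt_id (0:ℝ)).smul_const (bf φ (μ σ) z)).const_add z
  have h1 : HasFDerivAt g (fderiv ℝ g (z, σ)) (z + (0:ℝ) • bf φ (μ σ) z, σ + 0) := by
    simpa using (hg.differentiable one_ne_zero (z, σ)).hasFDerivAt
  have h3 := h1.comp_hasDerivAt (0:ℝ) (h2.prodMk h0)
  exact h3.unique h

lemma TD_sign {d : ℕ} {φ : ℝ → ℝ} {μ : ℝ → Measure (Phase d)}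
    {a : Phase d → ℝ} {Z : Phase d → ℝ → Phase d} {M0 k r : ℝ}
    {F : Finset (Phase d)} (hF : F.Nonempty) {K : ℝ} (hK : 0 < K) (hM0 : 0 ≤ M0)
    (hZ : ∀ y, ContDiff ℝ 1 (Z y)) {θ : ℝ → ℝ} (hθ : ContDiff ℝ 1 θ) (hm : Monotone θ) (A' : ℝ)
    {e Λ : ℝ} (hk : k = e * Λ) (he : e = 1 ∨ e = -1) {σ : ℝ} {z : Phase d}
    (hZd : ∀ y, HasDerivAt (Z y) (bf φ (μ σ) (Z y σ)) σ)
    (hΛ : ∀ y ∈ F, |dq (Z y σ - z) (bf φ (μ σ) (Z y σ) - bf φ (μ σ) z)| ≤ Λ * qd (Z y σ - z)) :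
    e * TD φ μ (fun w => θ (GG a Z M0 k r F K w) - A') (σ, z) ≤ 0 := by
  set b := bf φ (μ σ) z with hb
  set c' : Phase d → ℝ := fun y =>
    (M0 * Real.exp (-(k * (σ - r))) * (-k * qd (Z y σ - z) + dq (Z y σ - z) (bf φ (μ σ) (Z y σ) - b)))
    with hc'
  have h1 : ∀ y, HasDerivAt (fun ε : ℝ => cc a Z M0 k r y (z + ε • b, σ + ε)) (c' y) 0 :=
    fun y => cc_line (hZd y)
  have h2 : HasDerivAt (fun ε : ℝ => SS a Z M0 k r F K (z + ε • b, σ + ε))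
      (∑ y ∈ F, Real.exp (-(K * cc a Z M0 k r y (z + (0:ℝ) • b, σ + 0))) * (-(K * c' y))) 0 := by
    unfold SS
    exact HasDerivAt.fun_sum fun y _ => ((h1 y).const_mul K).neg.exp
  have h3 : HasDerivAt (fun ε : ℝ => GG a Z M0 k r F K (z + ε • b, σ + ε)) _ 0 :=
    (h2.log (SS_pos hF _).ne').const_mul (-(1 / K))
  have h4 : HasDerivAt (fun ε : ℝ => θ (GG a Z M0 k r F K (z + ε • b, σ + ε))) _ 0 :=
    ((hθ.differentiable one_ne_zero _).hasDerivAt).comp (0:ℝ) h3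
  rw [TD_of_line (g := fun w => θ (GG a Z M0 k r F K w) - A')
    ((hθ.comp (GG_contDiff hF hZ)).sub contDiff_const) (h4.sub_const A')]
  have hd : 0 ≤ deriv θ (GG a Z M0 k r F K (z + (0:ℝ) • b, σ + 0)) := hm.deriv_nonneg
  have hS := SS_pos (a := a) (Z := Z) (M0 := M0) (k := k) (r := r) hF (K := K)
    (z + (0:ℝ) • b, σ + 0)
  have hec : ∀ y ∈ F, e * c' y ≤ 0 := by
    intro y hy
    have := abs_le.1 (hΛ y hy)
    have hx : 0 ≤ M0 * Real.exp (-(k * (σ - r))) := mul_nonneg hM0 (Real.exp_pos _).le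
    have : e * (-k * qd (Z y σ - z) + dq (Z y σ - z) (bf φ (μ σ) (Z y σ) - b)) ≤ 0 := by
      rcases he with rfl | rfl <;> rw [hk] <;> linarith [this.1, this.2]
    calc e * c' y = (M0 * Real.exp (-(k * (σ - r)))) * (e * (-k * qd (Z y σ - z) + dq (Z y σ - z) (bf φ (μ σ) (Z y σ) - b))) := by
          rw [hc']; ring
      _ ≤ 0 := mul_nonpos_of_nonneg_of_nonpos hx this
  have hsum : 0 ≤ e * (∑ y ∈ F, Real.exp (-(K * cc a Z M0 k r y (z + (0:ℝ) • b, σ + 0))) * (-(K * c' y))) := by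
    rw [Finset.mul_sum]
    refine Finset.sum_nonneg fun y hy => ?_
    have h5 := mul_nonneg (mul_nonneg (Real.exp_pos (-(K * cc a Z M0 k r y (z + (0:ℝ) • b, σ + 0)))).le hK.le)
      (neg_nonneg.2 (hec y hy))
    linarith
  have h6 : 0 ≤ e * (∑ y ∈ F, Real.exp (-(K * cc a Z M0 k r y (z + (0:ℝ) • b, σ + 0))) * (-(K * c' y))) /
    SS a Z M0 k r F K (z + (0:ℝ) • b, σ + 0) := div_nonneg hsum hS.le
  have h7 := mul_nonneg (mul_nonneg hd (by positivity : 0 ≤ 1 / K)) h6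
  refine le_of_eq_of_le ?_ (neg_nonpos.2 h7)
  ring


lemma U_cs {d : ℕ} {a : Phase d → ℝ} {Z : Phase d → ℝ → Phase d} {M0 k r : ℝ}
    {F : Finset (Phase d)} (hF : F.Nonempty) {K : ℝ} (hK : 0 < K) (hM0 : 0 < M0)
    (hZ : ∀ y, ContDiff ℝ 1 (Z y)) {θ : ℝ → ℝ} {A A' : ℝ} (hA : ∀ u, A + 1 ≤ u → θ u = A')
    {R : ℝ} (hR : 0 < R) :
    HasCompactSupport (fun w : Phase d × ℝ => (θ (GG a Z M0 k r F K w) - A') * cut (w.2 / R)) := by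
  have hcE : Continuous fun τ : ℝ => Real.exp (k * (τ - r)) := by fun_prop
  have hcZ : Continuous fun τ : ℝ => ∑ y ∈ F, ‖Z y τ‖ :=
    continuous_finsetSum _ fun y _ => (hZ y).continuous.norm
  obtain ⟨E, hE⟩ := (isCompact_Icc (a := -(2 * R)) (b := 2 * R)).bddAbove_image hcE.continuousOn
  obtain ⟨R0, hR0⟩ := (isCompact_Icc (a := -(2 * R)) (b := 2 * R)).bddAbove_image hcZ.continuousOn
  set a0 := ∑ y ∈ F, |a y| with ha0
  -- choose radius
  set C := |A + 1 + Real.log F.card / K + a0| with hC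
  set D := max E 1 with hD
  have hDp : 0 < D := lt_of_lt_of_le one_pos (le_max_right _ _)
  set ρ := C * D / M0 + 1 with hρ
  have hCn : 0 ≤ C := abs_nonneg _
  have hρ1 : 1 ≤ ρ := by
    have : 0 ≤ C * D / M0 := by positivity
    linarith
  apply HasCompactSupport.intro ((isCompact_closedBall (0 : Phase d) (R0 + ρ)).prod
    (isCompact_Icc (a := -(2 * R)) (b := 2 * R)))
  rintro ⟨z, τ⟩ hw
  by_cases hτ : τ ∈ Icc (-(2 * R)) (2 * R)
  · have hz : R0 + ρ < ‖z‖ := by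
      by_contra hcon
      exact hw ⟨by simpa using hcon, hτ⟩
    have hG : A + 1 ≤ GG a Z M0 k r F K (z, τ) := by
      have h1 : ∀ y ∈ F, A + 1 + Real.log F.card / K ≤ cc a Z M0 k r y (z, τ) := by
        intro y hy
        unfold cc
        have h2 : ‖Z y τ‖ ≤ R0 :=
          (Finset.single_le_sum (f := fun y => ‖Z y τ‖) (fun _ _ => norm_nonneg _) hy).trans
            (hR0 ⟨τ, hτ, rfl⟩)
        have h3 : |a y| ≤ a0 :=
          Finset.single_le_sum (f := fun y => |a y|) (fun _ _ => abs_nonneg _) hy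
        have h4 : Real.exp (k * (τ - r)) ≤ D := (hE ⟨τ, hτ, rfl⟩).trans (le_max_left _ _)
        have h5 : ρ ≤ ‖Z y τ - z‖ := by
          have := norm_sub_norm_le z (Z y τ)
          rw [norm_sub_rev] at this
          linarith
        have h6 : ρ ≤ qd (Z y τ - z) := by
          have := norm_sq_le_qd (Z y τ - z)
          nlinarith
        have h7 : 1 / D ≤ Real.exp (-(k * (τ - r))) := by
          rw [Real.exp_neg, ← one_div]
          exact one_div_le_one_div_of_le (Real.exp_pos _) h4
        have h8 : M0 * (1 / D) * (C * D / M0) ≤ M0 * Real.exp (-(k * (τ - r))) * qd (Z y τ - z) := by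
          have : C * D / M0 ≤ qd (Z y τ - z) := by linarith
          gcongr
        have h9 : M0 * (1 / D) * (C * D / M0) = C := by field_simp
        have h10 := le_abs_self (A + 1 + Real.log F.card / K + a0)
        have h11 := neg_abs_le (a y)
        simp only
        linarith
      have := GG_lower hF hK h1
      linarith
    simp [hA _ hG]
  · have : cut (τ / R) = 0 := by
      apply cut_zero
      rw [abs_div, abs_of_pos hR, le_div_iff₀ hR]
      by_contra hcon
      push Not at hcon
      exact hτ (abs_le.1 hcon.le)
    simp [this]

lemma Hyp.softmin {d : ℕ} {T : ℝ} {φ : ℝ → ℝ} {Kφ : NNReal} {φM : ℝ}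
    {μ : ℝ → Measure (Phase d)}
    (H : Hyp T φ Kφ φM μ) {t1 B : ℝ} (ht1 : t1 < T)
    (hB : ∀ σ ∈ Icc 0 t1, Nw (μ σ) ≤ B)
    {a : Phase d → ℝ} {Z : Phase d → ℝ → Phase d} {M0 k r : ℝ}
    {F : Finset (Phase d)} (hF : F.Nonempty) {K : ℝ} (hK : 0 < K) (hM0 : 0 < M0)
    (hZ : ∀ y, ContDiff ℝ 1 (Z y))
    (hZd : ∀ y, ∀ σ ∈ Icc 0 t1, HasDerivAt (Z y) (bf φ (μ σ) (Z y σ)) σ)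
    {ρ : ℝ} (hρ : ∀ y ∈ F, ∀ σ ∈ Icc 0 t1, 1 + qd (Z y σ) ≤ ρ)
    {θ : ℝ → ℝ} (hθ : ContDiff ℝ 1 θ) (hm : Monotone θ) {A A' : ℝ}
    (hA : ∀ u, A + 1 ≤ u → θ u = A')
    {e : ℝ} (he : e = 1 ∨ e = -1)
    (hk : k = e * (1 + 3 * ((1 + φM) * B + Kφ * (B + ρ * B))))
    {p q : ℝ} (hp : 0 ≤ p) (hle : p ≤ q) (hq : q ≤ t1) :
    e * ((∫ z, θ (GG a Z M0 k r F K (z, q)) ∂(μ q)) - ∫ z, θ (GG a Z M0 k r F K (z, p)) ∂(μ p))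
      ≤ 0 := by
  have hR : 0 < t1 + 1 := by linarith
  set U : Phase d × ℝ → ℝ := fun w => (θ (GG a Z M0 k r F K w) - A') * cut (w.2 / (t1 + 1)) with hU
  have hUcs : HasCompactSupport U := U_cs hF hK hM0 hZ hA hR
  have hGc : ContDiff ℝ 1 (fun w => θ (GG a Z M0 k r F K w) - A') :=
    (hθ.comp (GG_contDiff hF hZ)).sub contDiff_const
  have hUc : ContDiff ℝ 1 U :=
    hGc.mul (cut_contDiff.comp (contDiff_snd.div_const _))
  have hpq : Icc p q ⊆ Ico 0 T := fun σ hσ => ⟨hp.trans hσ.1, (hσ.2.trans hq).trans_lt ht1⟩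
  have hpq1 : Icc p q ⊆ Icc 0 t1 := fun σ hσ => ⟨hp.trans hσ.1, (hσ.2.trans hq)⟩
  have hw := H.weakB hle hpq (fun σ hσ => hB σ (hpq1 hσ)) hUc hUcs
  have hUe : ∀ z, ∀ τ ∈ Ioo (-(t1 + 1)) (t1 + 1), U (z, τ) = θ (GG a Z M0 k r F K (z, τ)) - A' := by
    intro z τ hτ
    have : cut (τ / (t1 + 1)) = 1 := by
      apply cut_one
      rw [abs_div, abs_of_pos hR, div_le_one hR]
      exact abs_le.2 ⟨hτ.1.le, hτ.2.le⟩
    simp [hU, this]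
  have hmem : ∀ τ ∈ Icc 0 t1, τ ∈ Ioo (-(t1 + 1)) (t1 + 1) := fun τ hτ =>
    ⟨by linarith [hτ.1], by linarith [hτ.2]⟩
  have hTD : ∀ σ ∈ Icc 0 t1, ∀ z, e * TD φ μ U (σ, z) ≤ 0 := by
    intro σ hσ z
    rw [TD_congr (g' := fun w => θ (GG a Z M0 k r F K w) - A') isOpen_Ioo hUe (hmem σ hσ) z]
    refine TD_sign hF hK hM0.le hZ hθ hm A' hk he (fun y => hZd y σ hσ) ?_
    intro y hy
    have hσ' : σ ∈ Ico 0 T := ⟨hσ.1, hσ.2.trans_lt ht1⟩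
    have := H.fin hσ'
    exact dq_bf_sub H.lip H.pos H.bd (H.cpt σ hσ') (hB σ hσ) _ _ (hρ y hy σ hσ)
  have hint : ∀ τ ∈ Icc p q, ∫ z, U (z, τ) ∂(μ τ) =
      (∫ z, θ (GG a Z M0 k r F K (z, τ)) ∂(μ τ)) - (μ τ).real univ * A' := by
    intro τ hτ
    have := H.fin (hpq hτ)
    have hi : Integrable (fun z => θ (GG a Z M0 k r F K (z, τ))) (μ τ) := by
      apply integrable_of_cpt (H.cpt τ (hpq hτ))
      exact (hθ.comp (GG_contDiff hF hZ)).continuous.comp (by fun_prop)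
    simp_rw [fun z => hUe z τ (hmem τ (hpq1 hτ))]
    rw [integral_sub hi (integrable_const _)]
    simp
  rw [hint q ⟨hle, le_rfl⟩, hint p ⟨le_rfl, hle⟩,
    H.mass_const hp hle (hq.trans_lt ht1)] at hw
  have h1 : 0 ≤ ∫ s in p..q, -(e * ∫ z, TD φ μ U (s, z) ∂(μ s)) := by
    apply intervalIntegral.integral_nonneg hle
    intro σ hσ
    rw [← integral_const_mul, ← integral_neg]
    apply integral_nonneg
    intro z
    have := hTD σ (hpq1 hσ) z
    simp only [Pi.zero_apply]
    linarith
  rw [intervalIntegral.integral_neg, intervalIntegral.integral_const_mul, ← hw] at h1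
  linarith


lemma Hyp.curve_rho {d : ℕ} {T : ℝ} {φ : ℝ → ℝ} {Kφ : NNReal} {φM : ℝ}
    {μ : ℝ → Measure (Phase d)}
    (H : Hyp T φ Kφ φM μ) {t1 B : ℝ} (ht1 : t1 < T)
    (hB : ∀ σ ∈ Icc 0 t1, Nw (μ σ) ≤ B) {Y : ℝ → Phase d} (hY : IsChar φ μ t1 Y)
    {s t : ℝ} (hs : s ∈ Icc 0 t1) (ht : t ∈ Icc 0 t1) {q0 : ℝ} (hq0 : qd (Y s) ≤ q0) :
    1 + qd (Y t) ≤ (1 + q0) * Real.exp ((1 + 8 * (1 + φM) * B) * t1) := by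
  have h1 := H.curve_bd ht1 hB hY hs ht
  have hB0 : 0 ≤ B := Nw_nonneg.trans (hB s hs)
  have := H.pos
  have h2 : |t - s| ≤ t1 := abs_le.2 ⟨by linarith [ht.1, hs.2], by linarith [hs.1, ht.2]⟩
  refine h1.trans ?_
  have h3 := qd_nonneg (Y s)
  have h4 : 0 ≤ 1 + q0 := by linarith
  gcongr

lemma Hyp.flow_cont {d : ℕ} {T : ℝ} {φ : ℝ → ℝ} {Kφ : NNReal} {φM : ℝ}
    {μ : ℝ → Measure (Phase d)}
    (H : Hyp T φ Kφ φM μ) {t1 B : ℝ} (ht1 : t1 < T)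
    (hB : ∀ σ ∈ Icc 0 t1, Nw (μ σ) ≤ B) {Y : Phase d → ℝ → Phase d}
    (hY : ∀ y, IsChar φ μ t1 (Y y))
    {s t : ℝ} (hs : s ∈ Icc 0 t1) (ht : t ∈ Icc 0 t1) (hYs : ∀ y, Y y s = y) :
    Continuous fun y => Y y t := by
  rw [continuous_iff_continuousAt]
  intro y0
  set ρ := (1 + qd y0) * Real.exp ((1 + 8 * (1 + φM) * B) * t1) with hρ
  have h1 : ∀ τ ∈ Icc 0 t1, 1 + qd (Y y0 τ) ≤ ρ := fun τ hτ =>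
    H.curve_rho ht1 hB (hY y0) hs hτ (by rw [hYs])
  set C := Real.exp ((1 + 3 * ((1 + φM) * B + Kφ * (B + ρ * B))) * |t - s|) with hC
  have h2 : ∀ y, ‖Y y t - Y y0 t‖ ^ 2 ≤ qd (y0 - y) * C := by
    intro y
    have := H.curve_diff ht1 hB (hY y0) (hY y) h1 hs ht
    rw [hYs, hYs] at this
    rw [norm_sub_rev]
    exact (norm_sq_le_qd _).trans this
  have h3 : Tendsto (fun y => qd (y0 - y) * C) (nhds y0) (nhds 0) := by
    have hc : Continuous fun y : Phase d => qd (y0 - y) * C := by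
      have := @qd_cont d
      fun_prop
    have := hc.tendsto y0
    simpa [qd] using this
  have h4 : Tendsto (fun y => ‖Y y t - Y y0 t‖ ^ 2) (nhds y0) (nhds 0) :=
    squeeze_zero (fun _ => by positivity) h2 h3
  have h5 : Tendsto (fun y => ‖Y y t - Y y0 t‖) (nhds y0) (nhds 0) := by
    have := h4.sqrt
    simpa [Real.sqrt_sq] using this
  exact tendsto_iff_norm_sub_tendsto_zero.2 h5

lemma Hyp.onesided {d : ℕ} {T : ℝ} {φ : ℝ → ℝ} {Kφ : NNReal} {φM : ℝ}
    {μ : ℝ → Measure (Phase d)}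
    (H : Hyp T φ Kφ φM μ) {t1 B : ℝ} (ht1 : t1 < T)
    (hB : ∀ σ ∈ Icc 0 t1, Nw (μ σ) ≤ B) {Y : Phase d → ℝ → Phase d}
    (hY : ∀ y, IsChar φ μ t1 (Y y))
    {s t : ℝ} (hs : s ∈ Icc 0 t1) (ht : t ∈ Icc 0 t1) (hYs : ∀ y, Y y s = y)
    {h : Phase d → ℝ} (hh : ContDiff ℝ 1 h) (hcs : HasCompactSupport h) :
    ∫ z, h z ∂(μ t) ≤ ∫ z, h (Y z t) ∂(μ s) := by
  have hsT : s ∈ Ico 0 T := ⟨hs.1, hs.2.trans_lt ht1⟩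
  have htT : t ∈ Ico 0 T := ⟨ht.1, ht.2.trans_lt ht1⟩
  have := H.fin hsT
  have := H.fin htT
  have hfc : Continuous fun z => h (Y z t) := hh.continuous.comp (H.flow_cont ht1 hB hY hs ht hYs)
  choose Z hZ hZe hZd using fun y => H.curve_ext (hs.1.trans hs.2) ht1 hB (hY y)
  obtain ⟨Ks, hKs, hKs0⟩ := H.cpt s hsT
  have hK0 : IsCompact (insert (0 : Phase d) Ks) := hKs.insert 0
  obtain ⟨q0, hq0⟩ := hK0.bddAbove_image (@qd_cont d).continuousOn
  set ρ := (1 + q0) * Real.exp ((1 + 8 * (1 + φM) * B) * t1) with hρd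
  have hρ : ∀ y ∈ insert (0 : Phase d) Ks, ∀ τ ∈ Icc 0 t1, 1 + qd (Z y τ) ≤ ρ := by
    intro y hy τ hτ
    rw [hZe y τ hτ]
    exact H.curve_rho ht1 hB (hY y) hs hτ (by rw [hYs]; exact hq0 ⟨y, hy, rfl⟩)
  set Λ := 1 + 3 * ((1 + φM) * B + Kφ * (B + ρ * B)) with hΛ
  obtain ⟨l, hl⟩ := hh.lipschitzWith_of_hasCompactSupport hcs one_ne_zero
  obtain ⟨Hb, hHb⟩ := hcs.exists_bound_of_continuous hh.continuous
  have key : ∀ ε > 0, (∫ z, h z ∂(μ t)) - 2 * ε * (μ t).real univ ≤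
      (∫ z, h (Y z t) ∂(μ s)) + ε * (μ s).real univ := by
    intro ε hε
    set M0 : ℝ := (l:ℝ) ^ 2 / (4 * ε) + 1 with hM0d
    have hM0 : 0 < M0 := by positivity
    set L := Real.exp (Λ * |t - s|) with hL
    obtain ⟨F, hFK, hFc⟩ := hK0.elim_nhds_subcover
      (fun y => {z | h (Y y t) + M0 * L * qd (y - z) < h (Y z t) + ε}) (by
        intro y _
        apply IsOpen.mem_nhds
        · have := @qd_cont d
          exact isOpen_lt (by fun_prop) (hfc.add continuous_const)
        · simp [qd, hε])
    have hF : F.Nonempty := by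
      have := hFc (mem_insert _ _)
      simp only [mem_iUnion] at this
      obtain ⟨y, hy, _⟩ := this
      exact ⟨y, hy⟩
    have hlog : 0 ≤ Real.log F.card := Real.log_natCast_nonneg _
    set K := (Real.log F.card + 1) / ε with hKd
    have hK : 0 < K := by positivity
    have hlK : Real.log F.card / K ≤ ε := by
      rw [div_le_iff₀ hK, hKd]
      field_simp
      linarith
    obtain ⟨θ, hθ, hm, hθA, A', hA'⟩ := theta_exists (Hb + ε)
    obtain ⟨e, he, hes⟩ : ∃ e : ℝ, (e = 1 ∨ e = -1) ∧ e * (t - s) = |t - s| := by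
      rcases le_total s t with h | h
      · exact ⟨1, Or.inl rfl, by rw [abs_of_nonneg (sub_nonneg.2 h)]; ring⟩
      · exact ⟨-1, Or.inr rfl, by rw [abs_of_nonpos (sub_nonpos.2 h)]; ring⟩
    set k := e * Λ with hk
    set a : Phase d → ℝ := fun y => h (Y y t) with ha
    have hkey : ∫ z, θ (GG a Z M0 k t F K (z, t)) ∂(μ t) ≤
        ∫ z, θ (GG a Z M0 k t F K (z, s)) ∂(μ s) := by
      rcases le_total s t with hst | hst
      · rcases he with rfl | rfl
        · have := H.softmin (a := a) (r := t) ht1 hB hF hK hM0 hZ hZd (fun y hy => hρ y (hFK y hy))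
            hθ hm hA' (Or.inl rfl) hk hs.1 hst ht.2
          linarith
        · have : t = s := by
            rw [abs_of_nonneg (sub_nonneg.2 hst)] at hes; linarith
          rw [this]
      · rcases he with rfl | rfl
        · have : t = s := by
            rw [abs_of_nonpos (sub_nonpos.2 hst)] at hes; linarith
          rw [this]
        · have := H.softmin (a := a) (r := t) ht1 hB hF hK hM0 hZ hZd (fun y hy => hρ y (hFK y hy))
            hθ hm hA' (Or.inr rfl) hk ht.1 hst hs.2
          linarith
    have hcont : ∀ τ, Continuous fun z => θ (GG a Z M0 k t F K (z, τ)) := fun τ =>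
      (hθ.comp (GG_contDiff hF hZ)).continuous.comp (by fun_prop)
    have hlow : (∫ z, h z ∂(μ t)) - 2 * ε * (μ t).real univ ≤
        ∫ z, θ (GG a Z M0 k t F K (z, t)) ∂(μ t) := by
      have h1 : (∫ z, h z ∂(μ t)) - 2 * ε * (μ t).real univ = ∫ z, (h z - 2 * ε) ∂(μ t) := by
        rw [integral_sub (integrable_of_cpt (H.cpt t htT) hh.continuous) (integrable_const _)]
        simp [mul_comm]
      rw [h1]
      apply integral_mono (integrable_of_cpt (H.cpt t htT) (hh.continuous.sub continuous_const))
        (integrable_of_cpt (H.cpt t htT) (hcont t))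
      intro z
      simp only
      have h2 : h z - ε - Real.log F.card / K ≤ GG a Z M0 k t F K (z, t) := by
        apply GG_lower hF hK
        intro y hy
        simp only [cc, ha, sub_self, mul_zero, neg_zero, Real.exp_zero, mul_one]
        rw [hZe y t ht]
        have h3 := hl.dist_le_mul z (Y y t)
        rw [Real.dist_eq, dist_eq_norm, norm_sub_rev] at h3
        have h4 := (abs_le.1 h3).2
        have h5 := norm_sq_le_qd (Y y t - z)
        set x := ‖Y y t - z‖
        have h6 : (l:ℝ) * x ≤ (l:ℝ) ^ 2 / (4 * ε) * x ^ 2 + ε := by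
          have : (l:ℝ) ^ 2 / (4 * ε) * x ^ 2 + ε - l * x = (l * x - 2 * ε) ^ 2 / (4 * ε) := by
            field_simp; ring
          have h7 : 0 ≤ (l * x - 2 * ε) ^ 2 / (4 * ε) := by positivity
          linarith
        have h8 : (l:ℝ) ^ 2 / (4 * ε) * x ^ 2 ≤ M0 * qd (Y y t - z) := by
          have : (l:ℝ) ^ 2 / (4 * ε) ≤ M0 := by linarith
          gcongr
        linarith
      have h3 : h z - 2 * ε ≤ Hb + ε := by
        have := (abs_le.1 (hHb z)).2
        linarith
      show h z - 2 * ε ≤ _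
      rw [← hθA _ h3]
      exact hm (by linarith)
    have hupp : ∫ z, θ (GG a Z M0 k t F K (z, s)) ∂(μ s) ≤
        (∫ z, h (Y z t) ∂(μ s)) + ε * (μ s).real univ := by
      have h1 : (∫ z, h (Y z t) ∂(μ s)) + ε * (μ s).real univ = ∫ z, (h (Y z t) + ε) ∂(μ s) := by
        rw [integral_add (integrable_of_cpt (H.cpt s hsT) hfc) (integrable_const _)]
        simp [mul_comm, ha]
      rw [h1]
      apply integral_mono_ae (integrable_of_cpt (H.cpt s hsT) (hcont s))
        (integrable_of_cpt (H.cpt s hsT) (hfc.add continuous_const))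
      have hae : ∀ᵐ z ∂(μ s), z ∈ Ks := by rw [ae_iff]; exact hKs0
      filter_upwards [hae] with z hz
      have h2 := hFc (mem_insert_of_mem _ hz)
      simp only [mem_iUnion] at h2
      obtain ⟨y, hy, h3⟩ := h2
      have h3' : h (Y y t) + M0 * L * qd (y - z) < h (Y z t) + ε := h3
      have h4 : GG a Z M0 k t F K (z, s) ≤ h (Y z t) + ε := by
        refine (GG_upper hK hy).trans ?_
        simp only [cc, ha]
        rw [hZe y s hs, hYs]
        have h5 : -(k * (s - t)) = Λ * |t - s| := by rw [hk, ← hes]; ring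
        rw [h5]
        exact h3'.le
      have h5 : h (Y z t) + ε ≤ Hb + ε := by
        have := (abs_le.1 (hHb (Y z t))).2
        linarith
      show _ ≤ h (Y z t) + ε
      rw [← hθA _ h5]
      exact hm h4
    linarith
  apply le_of_forall_pos_le_add
  intro η hη
  have m1 : 0 ≤ (μ t).real univ := measureReal_nonneg
  have m2 : 0 ≤ (μ s).real univ := measureReal_nonneg
  set N := 2 * (μ t).real univ + (μ s).real univ + 1 with hN
  have hNp : 0 < N := by linarith
  have h1 := key (η / N) (by positivity)
  have h2 : η / N * N = η := by field_simp
  have h3 : η / N * (2 * (μ t).real univ + (μ s).real univ) ≤ η := by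
    have : 0 < η / N := by positivity
    rw [hN, mul_add, ← hN, mul_one] at h2
    linarith
  linarith

lemma Hyp.main {d : ℕ} {T : ℝ} {φ : ℝ → ℝ} {Kφ : NNReal} {φM : ℝ}
    {μ : ℝ → Measure (Phase d)}
    (H : Hyp T φ Kφ φM μ) {Y : Phase d → ℝ → Phase d}
    (hY : ∀ y, ∀ τ ∈ Ico 0 T, HasDerivWithinAt (Y y) (bf φ (μ τ) (Y y τ)) (Ico 0 T) τ)
    {s t : ℝ} (hs : s ∈ Ico 0 T) (ht : t ∈ Ico 0 T) (hYs : ∀ y, Y y s = y)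
    {h : Phase d → ℝ} (hh : ContDiff ℝ 1 h) (hcs : HasCompactSupport h) :
    ∫ z, h z ∂(μ t) = ∫ z, h (Y z t) ∂(μ s) := by
  have ht1 : max s t < T := max_lt hs.2 ht.2
  obtain ⟨B, hB⟩ := H.N_bd ht1
  have hs' : s ∈ Icc 0 (max s t) := ⟨hs.1, le_max_left _ _⟩
  have ht' : t ∈ Icc 0 (max s t) := ⟨ht.1, le_max_right _ _⟩
  have hsub : Icc 0 (max s t) ⊆ Ico 0 T := fun τ hτ => ⟨hτ.1, hτ.2.trans_lt ht1⟩
  have hC : ∀ y, IsChar φ μ (max s t) (Y y) := fun y τ hτ => (hY y τ (hsub hτ)).mono hsub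
  apply le_antisymm
  · exact H.onesided ht1 hB hC hs' ht' hYs hh hcs
  · have := H.onesided ht1 hB hC hs' ht' hYs hh.neg (h := fun z => - h z) hcs.neg
    rw [integral_neg, integral_neg] at this
    linarith

/-- the solution at time `t` is the pushforward of the solution at time `s`
under the bi-characteristic flow: `∫ h dμ_t = ∫ h(X(t;s,x,v), V(t;s,x,v)) dμ_s`. -/
theorem kinetic_herding_pushforward
    {d : ℕ} (hd : 1 ≤ d) (T : ℝ) (hT : 0 < T)
    (φ : ℝ → ℝ) (Kφ : NNReal) (hLip : LipschitzWith Kφ φ)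
    (φM : ℝ) (hφM : 0 < φM) (hφ : ∀ r, 0 ≤ φ r ∧ φ r ≤ φM)
    (μ : ℝ → Measure (Phase d))
    (hsol : IsMVSol 1 1 1 φ (Set.Ico 0 T) μ)
    (hcpt : ∀ t ∈ Set.Ico (0:ℝ) T, MeasureCompactSupport (μ t)) :
    ∀ s ∈ Set.Ico (0:ℝ) T, ∀ t ∈ Set.Ico (0:ℝ) T,
      ∀ X V : Euc d → Euc d → ℝ → Euc d,
        (∀ x v, X x v s = x ∧ V x v s = v) →
        (∀ x v, ∀ τ ∈ Set.Ico (0:ℝ) T,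
          HasDerivWithinAt (X x v) (V x v τ) (Set.Ico 0 T) τ ∧
          HasDerivWithinAt (V x v)
            (herdQ 1 1 1 φ (μ τ) (X x v τ) (V x v τ)) (Set.Ico 0 T) τ) →
        ∀ h : Phase d → ℝ, ContDiff ℝ 1 h → HasCompactSupport h →
          (∫ z, h z ∂(μ t)) = ∫ z, h (X z.1 z.2 t, V z.1 z.2 t) ∂(μ s) := by
  intro s hs t ht X V h0 hXV h hh hcs
  have H : Hyp T φ Kφ φM μ := ⟨hLip, hφM, hφ, hsol, hcpt⟩
  refine H.main (Y := fun y τ => (X y.1 y.2 τ, V y.1 y.2 τ)) ?_ hs ht ?_ hh hcs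
  · intro y τ hτ
    obtain ⟨h1, h2⟩ := hXV y.1 y.2 τ hτ
    exact h1.prodMk h2
  · intro y
    obtain ⟨h1, h2⟩ := h0 y.1 y.2
    ext1 <;> simp [h1, h2]
end
end
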